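/- arXiv:1002.3247 — 2 statements merged into one kernel-verified Lean document; each statement's English description precedes it below -/
import Mathlib

section
/- Let C be a Hom-finite extension-closed subcategory of an abelian k-category and M = M₁ ⊕ … ⊕ Mₙ with Ext¹_C(M,M) = 0 and Γ = End_C(M) of finite global dimension. If for each i the minimal left add(⊕_{j<i} Mⱼ)-approximation fᵢ: Mᵢ → Mᵢ' is surjective, then Γ is quasihereditary with respect to the ordering Hom_C(Mₙ,M), …, Hom_C(M₁,M) of the indecomposable projectives, with standard modules Δᵢ = Hom_C(Ker fᵢ, M), and moreover each Δᵢ has projective dimension at most 1 (i.e. Γ is left strongly quasihereditary). -/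
open CategoryTheory CategoryTheory.Limits

attribute [local instance] CategoryTheory.Limits.HasFiniteBiproducts.of_hasFiniteProducts
attribute [local instance] CategoryTheory.Limits.hasBinaryBiproducts_of_finite_biproducts

/-!
STATEMENT 5. Let C be a Hom-finite extension-closed subcategory of an abelian k-category
and M = M₁ ⊕ … ⊕ Mₙ with Ext¹_C(M,M) = 0 and Γ = End_C(M) of finite global dimension.
If for each i the minimal left add(⊕_{j<i} Mⱼ)-approximation fᵢ : Mᵢ → Mᵢ' is surjective,
then Γ is quasihereditary with respect to the ordering Hom(Mₙ,M),…,Hom(M₁,M) of the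
indecomposable projectives, with standard modules Δᵢ = Hom_C(Ker fᵢ, M), and each Δᵢ has
projective dimension at most 1 (Γ is left strongly quasihereditary).

Quasiheredity is expressed by: (i) each Δᵢ is the largest quotient of
Pᵢ = Hom_C(Mᵢ, M) with composition factors among the S_r, r ≥ i (the kernel of the
canonical surjection Pᵢ → Δᵢ is the trace of the Pⱼ, j < i), (ii) each indecomposable
projective Pᵢ has a filtration by the standard modules Δⱼ, and (together with the
assumed finiteness of the global dimension) (iii) each Δᵢ has pd ≤ 1.
-/

universe v u

noncomputable instance homEndModule {𝒜 : Type u} [Category.{v} 𝒜] [Abelian 𝒜] (X M : 𝒜) :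
    Module (End M) (X ⟶ M) where
  smul γ φ := φ ≫ γ
  one_smul φ := Category.comp_id φ
  mul_smul γ δ φ := (Category.assoc φ δ γ).symm
  smul_zero _ := Limits.zero_comp
  smul_add _ _ _ := Preadditive.add_comp _ _ _ _ _ _
  add_smul _ _ _ := Preadditive.comp_add _ _ _ _ _ _
  zero_smul _ := Limits.comp_zero

def pdLE (R : Type v) [Ring R] : ℕ → ModuleCat.{v} R → Prop
  | 0, D => Module.Projective R D
  | n + 1, D => ∃ (P : ModuleCat.{v} R) (p : P →ₗ[R] D), Module.Projective R P ∧
      Function.Surjective p ∧ pdLE R n (ModuleCat.of R (LinearMap.ker p))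

def BelowAdd {𝒜 : Type u} [Category.{v} 𝒜] [Abelian 𝒜] {n : ℕ} (Mi : Fin n → 𝒜)
    (i : Fin n) (X : 𝒜) : Prop :=
  ∃ (m : ℕ) (s : X ⟶ ⨁ fun q : Fin m × {j : Fin n // j < i} => Mi q.2.1)
    (r : (⨁ fun q : Fin m × {j : Fin n // j < i} => Mi q.2.1) ⟶ X), s ≫ r = 𝟙 X

noncomputable def preMap {𝒜 : Type u} [Category.{v} 𝒜] [Abelian 𝒜] {X Y M : 𝒜}
    (g : X ⟶ Y) : (Y ⟶ M) →ₗ[End M] (X ⟶ M) where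
  toFun φ := g ≫ φ
  map_add' _ _ := Preadditive.comp_add _ _ _ _ _ _
  map_smul' γ φ := (Category.assoc g φ γ).symm

/-- `X` admits a filtration with successive subquotients among the `Δ j`. -/
def InFilt {R : Type v} [Ring R] {n : ℕ} (Δ : Fin n → ModuleCat.{v} R)
    (X : ModuleCat.{v} R) : Prop :=
  ∃ (m : ℕ) (c : Fin (m + 1) → Submodule R X), Monotone c ∧ c 0 = ⊥ ∧ c (Fin.last m) = ⊤ ∧
    ∀ l : Fin m, ∃ j : Fin n,
      Nonempty ((↥(c l.succ) ⧸ Submodule.comap (c l.succ).subtype (c l.castSucc)) ≃ₗ[R] Δ j)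

theorem isUnit_or_isNilpotent_of_trivial_idempotents (k : Type*) [Field k] {A : Type*} [Ring A]
    [Algebra k A] [Module.Finite k A] (hA : ∀ e : A, e * e = e → e = 0 ∨ e = 1) (a : A) :
    IsUnit a ∨ IsNilpotent a := by
  have : IsArtinian (Algebra.adjoin k {a}) (Algebra.adjoin k {a}) :=
    isArtinian_of_tower k inferInstance
  let x : Algebra.adjoin k {a} := ⟨a, Algebra.self_mem_adjoin_singleton k a⟩
  have : IsMulCommutative (Algebra.adjoin k {a}) := Algebra.isMulCommutative_adjoin k (by simp)
  obtain ⟨n, y, hy⟩ := IsArtinian.exists_pow_succ_smul_dvd x (1 : Algebra.adjoin k {a})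
  simp only [smul_eq_mul, mul_one] at hy
  have key (m : ℕ) : x ^ n = x ^ (n + m) * y ^ m := by
    induction m with
    | zero => simp
    | succ m ih =>
      calc x ^ n = x ^ (n + m) * y ^ m := ih
        _ = x ^ m * (x ^ n) * y ^ m := by ring
        _ = x ^ m * (x ^ (n + 1) * y) * y ^ m := by rw [hy]
        _ = _ := by ring
  have hidem : (x ^ n * y ^ n) * (x ^ n * y ^ n) = x ^ n * y ^ n := by
    calc _ = (x ^ (n + n) * y ^ n) * y ^ n := by ring
      _ = _ := by rw [← key]
  have hxn : x ^ n = x ^ n * (x ^ n * y ^ n) := by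
    calc x ^ n = x ^ (n + n) * y ^ n := key n
      _ = _ := by ring
  rcases hA _ (congrArg Subtype.val hidem) with h | h
  · right
    have h0 : x ^ n * y ^ n = 0 := Subtype.ext h
    rw [h0, mul_zero] at hxn
    exact ⟨n, congrArg Subtype.val hxn⟩
  · left
    have h1 : x ^ n * y ^ n = 1 := Subtype.ext h
    have hx : x * y = 1 := by
      calc x * y = (x ^ n * y ^ n) * (x * y) := by rw [h1, one_mul]
        _ = (x ^ (n + 1) * y) * y ^ n := by ring
        _ = 1 := by rw [← h1, ← hy]
    exact (IsUnit.of_mul_eq_one y hx).map (Algebra.adjoin k {a}).val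

theorem isLocalRing_of_trivial_idempotents (k : Type*) [Field k] {A : Type*} [Ring A] [Nontrivial A]
    [Algebra k A] [Module.Finite k A] (hA : ∀ e : A, e * e = e → e = 0 ∨ e = 1) :
    IsLocalRing A :=
  .of_isUnit_or_isUnit_one_sub_self fun a =>
    (isUnit_or_isNilpotent_of_trivial_idempotents k hA a).imp id fun h => h.isUnit_one_sub

section

variable {𝒜 : Type u} [Category.{v} 𝒜] [Abelian 𝒜]

theorem CategoryTheory.Retract.exists_iso_biprod {X Y : 𝒜} (h : Retract X Y) :
    Nonempty (Y ≅ X ⊞ cokernel h.i) :=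
  have : IsSplitMono h.i := ⟨⟨h.splitMono⟩⟩
  ⟨biprod.uniqueUpToIso _ _ (isBilimitBinaryBiconeOfIsSplitMonoOfCokernel (cokernelIsCokernel h.i))⟩

theorem CategoryTheory.Retract.isZero_or_isIso {X Y : 𝒜} (h : Retract X Y) (hY : Indecomposable Y) :
    IsZero X ∨ IsIso h.i := by
  obtain ⟨e⟩ := h.exists_iso_biprod
  refine (hY.2 _ _ e).imp id fun h0 => ?_
  have : IsSplitMono h.i := ⟨⟨h.splitMono⟩⟩
  have : Epi h.i := Preadditive.epi_of_isZero_cokernel _ h0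
  exact isIso_of_epi_of_isSplitMono _

theorem CategoryTheory.Indecomposable.isLocalRing_end (k : Type*) [Field k] [Linear k 𝒜] {X : 𝒜}
    (hX : Indecomposable X) [Module.Finite k (X ⟶ X)] : IsLocalRing (End X) := by
  have : Module.Finite k (End X) := ‹Module.Finite k (X ⟶ X)›
  have : Nontrivial (End X) := ⟨𝟙 X, 0, fun h => hX.1 ((IsZero.iff_id_eq_zero X).2 h)⟩
  refine isLocalRing_of_trivial_idempotents k fun e he => ?_
  obtain ⟨Y, i, r, hir, hri⟩ := IsIdempotentComplete.idempotents_split X (e : X ⟶ X) he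
  rcases (Retract.mk i r hir).isZero_or_isIso hX with h | h
  · left
    rw [← hri, h.eq_of_src i 0, comp_zero]
  · right
    have : IsIso i := h
    have hr : r = inv i := by rw [← cancel_epi i, hir, IsIso.hom_inv_id]
    rw [← hri, hr, IsIso.inv_hom_id]
    rfl

theorem module_finite_hom_of_retract (k : Type*) [Field k] [Linear k 𝒜] {X X' Y Y' : 𝒜}
    (h : Retract X X') (h' : Retract Y Y') [Module.Finite k (X' ⟶ Y')] :
    Module.Finite k (X ⟶ Y) :=
  .of_injective ((Linear.rightComp k X' h'.i).comp (Linear.leftComp k Y h.r)) fun a b hab => by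
    have : h.r ≫ a ≫ h'.i = h.r ≫ b ≫ h'.i := by simpa using hab
    simpa using h.i ≫= this =≫ h'.r

theorem module_finite_hom_biproduct (k : Type*) [Field k] [Linear k 𝒜] {J : Type} [Finite J]
    (Y : J → 𝒜) [∀ p q, Module.Finite k (Y p ⟶ Y q)] : Module.Finite k (⨁ Y ⟶ ⨁ Y) := by
  have := Fintype.ofFinite J
  refine .of_injective (M := ⨁ Y ⟶ ⨁ Y) (N := ∀ p q, Y p ⟶ Y q)
    (LinearMap.pi fun p => LinearMap.pi fun q =>
      (Linear.rightComp k _ (biproduct.π Y q)).comp (Linear.leftComp k _ (biproduct.ι Y p)))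
    fun a b hab => ?_
  ext q p
  simpa using congrFun (congrFun hab p) q

theorem CategoryTheory.Retract.sum_comp_eq_id {J : Type} [Fintype J] {Y : J → 𝒜} {X : 𝒜}
    (h : Retract X (⨁ Y)) : ∑ q, (h.i ≫ biproduct.π Y q) ≫ biproduct.ι Y q ≫ h.r = 𝟙 X := by
  trans h.i ≫ 𝟙 (⨁ Y) ≫ h.r
  · rw [← biproduct.total, Preadditive.sum_comp, Preadditive.comp_sum]
    simp
  · simp

/-- Krull–Schmidt in the form of an induction principle. -/
theorem retract_biproduct_induction (k : Type*) [Field k] [Linear k 𝒜] {J : Type} [Finite J]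
    (Y : J → 𝒜) (hY : ∀ q, Indecomposable (Y q)) [∀ p q, Module.Finite k (Y p ⟶ Y q)]
    (P : ObjectProperty 𝒜) [P.IsClosedUnderIsomorphisms] (hzero : ∀ X, IsZero X → P X)
    (hbiprod : ∀ A B, P A → P B → P (A ⊞ B)) (hP : ∀ q, P (Y q)) {X : 𝒜} (h : Retract X (⨁ Y)) :
    P X := by
  have := Fintype.ofFinite J
  have := module_finite_hom_biproduct k Y
  have hfin {Z : 𝒜} (h : Retract Z (⨁ Y)) : Module.Finite k (Z ⟶ Z) :=
    module_finite_hom_of_retract k h h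
  induction hd : Module.finrank k (X ⟶ X) using Nat.strong_induction_on generalizing X with
  | h d ih =>
    subst hd
    have := hfin h
    have ih' {A : 𝒜} (hA : Retract A X) (hne : ¬ IsIso hA.i) : P A := by
      have := hfin (hA.trans h)
      refine ih _ ?_ (hA.trans h) rfl
      let φ := (Linear.rightComp k X hA.i).comp (Linear.leftComp k A hA.r)
      have hφ : Function.Injective φ := fun a b hab => by
        have : hA.r ≫ a ≫ hA.i = hA.r ≫ b ≫ hA.i := by simpa [φ] using hab
        simpa using hA.i ≫= this =≫ hA.r
      refine lt_of_le_of_ne (LinearMap.finrank_le_finrank_of_injective hφ) fun heq => hne ?_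
      obtain ⟨a, ha⟩ := (LinearMap.injective_iff_surjective_of_finrank_eq_finrank heq).1 hφ (𝟙 X)
      have ha' : (hA.r ≫ a) ≫ hA.i = 𝟙 X := by simpa [φ] using ha
      have : IsSplitEpi hA.i := ⟨⟨⟨_, ha'⟩⟩⟩
      have : Mono hA.i := (SplitMono.mono ⟨hA.r, hA.retract⟩)
      exact isIso_of_mono_of_isSplitEpi _
    by_cases h0 : IsZero X
    · exact hzero X h0
    by_cases hX : Indecomposable X
    · have := hX.isLocalRing_end k
      have hsum : ∑ q, (show End X from (h.i ≫ biproduct.π Y q) ≫ biproduct.ι Y q ≫ h.r) = 1 := h.sum_comp_eq_id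
      obtain ⟨q, -, hq⟩ := IsLocalRing.exists_of_isUnit_sum (hsum ▸ isUnit_one)
      have hq' : IsIso ((h.i ≫ biproduct.π Y q) ≫ biproduct.ι Y q ≫ h.r) :=
        (isUnit_iff_isIso _).1 hq
      let hret : Retract X (Y q) :=
        { i := h.i ≫ biproduct.π Y q
          r := (biproduct.ι Y q ≫ h.r) ≫ inv ((h.i ≫ biproduct.π Y q) ≫ biproduct.ι Y q ≫ h.r)
          retract := by rw [← Category.assoc]; exact IsIso.hom_inv_id _ }
      have := (hret.isZero_or_isIso (hY q)).resolve_left h0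
      exact P.prop_of_iso (asIso hret.i).symm (hP q)
    · have : ∃ A B : 𝒜, ∃ _ : X ≅ A ⊞ B, ¬ IsZero A ∧ ¬ IsZero B := by
        simpa [Indecomposable, h0] using hX
      obtain ⟨A, B, e, hA, hB⟩ := this
      refine P.prop_of_iso e.symm (hbiprod A B ?_ ?_)
      · let hr : Retract A X := ⟨biprod.inl ≫ e.inv, e.hom ≫ biprod.fst, by simp⟩
        refine ih' hr fun hi => hB ?_
        have : IsIso (biprod.inl ≫ e.inv) := hi
        have : IsIso (biprod.inl : A ⟶ A ⊞ B) := IsIso.of_isIso_comp_right _ e.inv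
        exact (Biprod.isIso_inl_iff_isZero A B).1 this
      · let hr : Retract B X := ⟨biprod.inr ≫ e.inv, e.hom ≫ biprod.snd, by simp⟩
        refine ih' hr fun hi => hA ?_
        have : IsIso (biprod.inr ≫ e.inv) := hi
        have : IsIso (biprod.inr : B ⟶ A ⊞ B) := IsIso.of_isIso_comp_right _ e.inv
        rw [IsZero.iff_id_eq_zero, ← biprod.inl_fst (X := A) (Y := B),
          ← cancel_mono (biprod.inl : A ⟶ A ⊞ B)]
        have h1 : (biprod.fst : A ⊞ B ⟶ A) = 0 := by
          rw [← cancel_epi (biprod.inr : B ⟶ A ⊞ B)]; simp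
        simp [h1]

end

section

variable {𝒜 : Type u} [Category.{v} 𝒜] [Abelian 𝒜]

theorem CategoryTheory.ShortComplex.ShortExact.exists_lift_of_forall_section
    {S : ShortComplex 𝒜} (hS : S.ShortExact) {T : 𝒜}
    (hT : ∀ (E : 𝒜) (f : S.X₁ ⟶ E) (g : E ⟶ T) (w : f ≫ g = 0),
      (ShortComplex.mk f g w).ShortExact → ∃ s : T ⟶ E, s ≫ g = 𝟙 T) (h : T ⟶ S.X₃) :
    ∃ l : T ⟶ S.X₂, l ≫ S.g = h := by
  have := hS.mono_f
  have := hS.epi_g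
  let i : S.X₁ ⟶ pullback S.g h := pullback.lift S.f 0 (by simp)
  have hi : i ≫ pullback.fst S.g h = S.f := pullback.lift_fst _ _ _
  have hi' : i ≫ pullback.snd S.g h = 0 := pullback.lift_snd _ _ _
  have : Mono i := by
    have : Mono (i ≫ pullback.fst S.g h) := hi ▸ hS.mono_f
    exact mono_of_mono i (pullback.fst S.g h)
  have hex : (ShortComplex.mk i (pullback.snd S.g h) hi').Exact := by
    refine ShortComplex.exact_of_f_is_kernel _ (KernelFork.IsLimit.ofι' _ _ fun {A} x hx => ?_)
    have hx' : (x ≫ pullback.fst S.g h) ≫ S.g = 0 := by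
      rw [Category.assoc, pullback.condition, ← Category.assoc, hx, zero_comp]
    refine ⟨hS.exact.lift _ hx', ?_⟩
    apply pullback.hom_ext
    · rw [Category.assoc, hi, hS.exact.lift_f]
    · rw [Category.assoc, hi', comp_zero]; exact hx.symm
  obtain ⟨s, hs⟩ := hT _ i (pullback.snd S.g h) hi' ⟨hex⟩
  exact ⟨s ≫ pullback.fst S.g h, by
    rw [Category.assoc, pullback.condition, ← Category.assoc, hs, Category.id_comp]⟩

theorem CategoryTheory.ShortComplex.ShortExact.exists_desc_of_forall_section
    {S : ShortComplex 𝒜} (hS : S.ShortExact) {T : 𝒜}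
    (hT : ∀ (E : 𝒜) (f : T ⟶ E) (g : E ⟶ S.X₃) (w : f ≫ g = 0),
      (ShortComplex.mk f g w).ShortExact → ∃ s : S.X₃ ⟶ E, s ≫ g = 𝟙 S.X₃) (h : S.X₁ ⟶ T) :
    ∃ l : S.X₂ ⟶ T, S.f ≫ l = h := by
  have := hS.mono_f
  have := hS.epi_g
  let p : pushout S.f h ⟶ S.X₃ := pushout.desc S.g 0 (by simp)
  have hp : pushout.inl S.f h ≫ p = S.g := pushout.inl_desc _ _ _
  have hp' : pushout.inr S.f h ≫ p = 0 := pushout.inr_desc _ _ _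
  have : Epi p := by
    have : Epi (pushout.inl S.f h ≫ p) := hp ▸ hS.epi_g
    exact epi_of_epi (pushout.inl S.f h) p
  have hex : (ShortComplex.mk (pushout.inr S.f h) p hp').Exact := by
    refine ShortComplex.exact_of_g_is_cokernel _
      (CokernelCofork.IsColimit.ofπ' _ _ fun {A} x hx => ?_)
    have hx' : S.f ≫ pushout.inl S.f h ≫ x = 0 := by
      rw [← Category.assoc, pushout.condition, Category.assoc, hx, comp_zero]
    refine ⟨hS.exact.desc _ hx', ?_⟩
    apply pushout.hom_ext
    · rw [← Category.assoc, hp, hS.exact.g_desc]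
    · rw [← Category.assoc, hp', zero_comp]; exact hx.symm
  obtain ⟨s, hs⟩ := hT _ (pushout.inr S.f h) p hp' ⟨hex⟩
  let σ := ShortComplex.Splitting.ofExactOfSection _ hex s hs inferInstance
  exact ⟨pushout.inl S.f h ≫ σ.r, by
    rw [← Category.assoc, pushout.condition, Category.assoc]
    exact (h ≫= σ.f_r).trans (Category.comp_id h)⟩

theorem exists_section_of_retract_biproduct {T E X : 𝒜} {J : Type} [Finite J] {Y : J → 𝒜}
    (hY : ∀ q, Nonempty (Retract (Y q) T)) (h : Retract X (⨁ Y)) (g : E ⟶ X)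
    (hg : ∀ x : T ⟶ X, ∃ l : T ⟶ E, l ≫ g = x) : ∃ s : X ⟶ E, s ≫ g = 𝟙 X := by
  choose l hl using fun q => hg ((hY q).some.r ≫ biproduct.ι Y q ≫ h.r)
  have hl' : biproduct.desc (fun q => (hY q).some.i ≫ l q) ≫ g = h.r := by
    ext q
    simp [hl]
  exact ⟨h.i ≫ biproduct.desc (fun q => (hY q).some.i ≫ l q), by
    rw [Category.assoc, hl', h.retract]⟩

theorem preMap_injective {X Y M : 𝒜} (g : X ⟶ Y) [Epi g] :
    Function.Injective (preMap (M := M) g) := fun _ _ h => (cancel_epi g).1 h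

theorem CategoryTheory.ShortComplex.ShortExact.ker_preMap {S : ShortComplex 𝒜}
    (hS : S.ShortExact) (M : 𝒜) :
    LinearMap.ker (preMap (M := M) S.f) = LinearMap.range (preMap (M := M) S.g) := by
  have := hS.epi_g
  ext φ
  constructor
  · exact fun h => ⟨hS.exact.desc φ h, hS.exact.g_desc φ h⟩
  · rintro ⟨ψ, rfl⟩
    change S.f ≫ S.g ≫ ψ = 0
    rw [S.zero_assoc, zero_comp]

/-- Full faithfulness of `Hom(-, M)` on retracts of `M`. -/
theorem exists_eq_preMap {X Y M : 𝒜} (h : Retract Y M) (φ : (Y ⟶ M) →ₗ[End M] (X ⟶ M)) :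
    ∃ g : X ⟶ Y, φ = preMap g := by
  refine ⟨φ h.i ≫ h.r, LinearMap.ext fun ψ => ?_⟩
  change φ ψ = (φ h.i ≫ h.r) ≫ ψ
  have : φ h.i ≫ h.r ≫ ψ = φ (h.i ≫ h.r ≫ ψ) := (φ.map_smul (show End M from h.r ≫ ψ) h.i).symm
  rw [Category.assoc, this, h.retract_assoc]

theorem projective_hom_of_retract {X Y M : 𝒜} (h : Retract X Y)
    [Module.Projective (End M) (Y ⟶ M)] : Module.Projective (End M) (X ⟶ M) :=
  .of_split (preMap h.r) (preMap h.i) (LinearMap.ext fun φ => h.retract_assoc φ)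

theorem projective_hom_self (M : 𝒜) : Module.Projective (End M) (M ⟶ M) :=
  let e : End M ≃ₗ[End M] (M ⟶ M) :=
    { AddEquiv.refl (M ⟶ M) with map_smul' := fun _ _ => rfl }
  .of_equiv e

theorem projective_hom_biproduct {M : 𝒜} {J : Type} [Finite J] (Y : J → 𝒜)
    [∀ q, Module.Projective (End M) (Y q ⟶ M)] : Module.Projective (End M) (⨁ Y ⟶ M) := by
  have := Fintype.ofFinite J
  classical
  have : Module.Projective (End M) (∀ q, Y q ⟶ M) :=
    .of_equiv (DFinsupp.linearEquivFunOnFintype (R := End M) (M := fun q => (Y q ⟶ M)))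
  refine .of_split (M := ∀ q, Y q ⟶ M) (LinearMap.pi fun q => preMap (biproduct.ι Y q))
    (∑ q, (preMap (biproduct.π Y q)).comp (LinearMap.proj q)) (LinearMap.ext fun φ => ?_)
  simp only [LinearMap.comp_apply, LinearMap.sum_apply, LinearMap.id_apply]
  change ∑ q, biproduct.π Y q ≫ biproduct.ι Y q ≫ φ = φ
  simp_rw [← Category.assoc]
  rw [← Preadditive.sum_comp, biproduct.total, Category.id_comp]

end
section

variable {R : Type v} [Ring R] {n : ℕ} {Δ : Fin n → ModuleCat.{v} R}
  {A B D : Type v} [AddCommGroup A] [Module R A] [AddCommGroup B] [Module R B]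
  [AddCommGroup D] [Module R D]

theorem inFilt_iff : InFilt Δ (ModuleCat.of R A) ↔
    ∃ (m : ℕ) (c : Fin (m + 1) → Submodule R A), Monotone c ∧ c 0 = ⊥ ∧ c (Fin.last m) = ⊤ ∧
      ∀ l : Fin m, ∃ (j : Fin n) (q : c l.succ →ₗ[R] Δ j), Function.Surjective q ∧
        ∀ x, q x = 0 ↔ (x : A) ∈ c l.castSucc := by
  refine exists_congr fun m => exists_congr fun c => and_congr_right fun _ => and_congr_right
    fun _ => and_congr_right fun _ => forall_congr' fun l => exists_congr fun j => ⟨?_, ?_⟩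
  · rintro ⟨e⟩
    refine ⟨e.toLinearMap ∘ₗ Submodule.mkQ _, e.surjective.comp (Submodule.mkQ_surjective _),
      fun x => ?_⟩
    simp
  · rintro ⟨q, hq, hk⟩
    have : Submodule.comap (c l.succ).subtype (c l.castSucc) = LinearMap.ker q :=
      Submodule.ext fun x => (hk x).symm
    exact ⟨(Submodule.quotEquivOfEq _ _ this).trans (q.quotKerEquivOfSurjective hq)⟩

theorem exists_quotient_map_of_injective (f : A →ₗ[R] B) (hf : Function.Injective f)
    {c c' : Submodule R A} (q : c' →ₗ[R] D) (hq : Function.Surjective q)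
    (hk : ∀ x, q x = 0 ↔ (x : A) ∈ c) :
    ∃ q' : c'.map f →ₗ[R] D, Function.Surjective q' ∧
      ∀ x, q' x = 0 ↔ (x : B) ∈ c.map f := by
  let e := Submodule.equivMapOfInjective f hf c'
  refine ⟨q ∘ₗ e.symm.toLinearMap, hq.comp e.symm.surjective, fun x => ?_⟩
  obtain ⟨y, rfl⟩ := e.surjective x
  simpa [e, hf.eq_iff] using hk y

theorem InFilt.of_subsingleton [Subsingleton A] : InFilt Δ (ModuleCat.of R A) :=
  inFilt_iff.2 ⟨0, fun _ => ⊥, monotone_const, rfl, Subsingleton.elim _ _, fun l => l.elim0⟩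

theorem InFilt.of_linearEquiv (e : A ≃ₗ[R] B) (hA : InFilt Δ (ModuleCat.of R A)) :
    InFilt Δ (ModuleCat.of R B) := by
  obtain ⟨m, c, hc, h0, h1, hq⟩ := inFilt_iff.1 hA
  refine inFilt_iff.2 ⟨m, fun l => (c l).map e.toLinearMap, fun _ _ h => Submodule.map_mono (hc h),
    by simp [h0], by simp [h1], fun l => ?_⟩
  obtain ⟨j, q, hq, hk⟩ := hq l
  exact ⟨j, exists_quotient_map_of_injective e.toLinearMap e.injective q hq hk⟩

theorem InFilt.of_standard_quotient {j : Fin n}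
    (f : A →ₗ[R] B) (g : B →ₗ[R] Δ j) (hf : Function.Injective f) (hg : Function.Surjective g)
    (hfg : LinearMap.ker g = LinearMap.range f) (hA : InFilt Δ (ModuleCat.of R A)) :
    InFilt Δ (ModuleCat.of R B) := by
  obtain ⟨m, c, hc, h0, h1, hq⟩ := inFilt_iff.1 hA
  let d : Fin (m + 2) → Submodule R B :=
    Fin.snoc (α := fun _ => Submodule R B) (fun l => (c l).map f) ⊤
  have hd (l : Fin (m + 1)) : d l.castSucc = (c l).map f := Fin.snoc_castSucc _ _ _
  have hd' : d (Fin.last (m + 1)) = ⊤ := Fin.snoc_last _ _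
  refine inFilt_iff.2 ⟨m + 1, d, ?_, ?_, hd', ?_⟩
  · refine Fin.monotone_iff_le_succ.2 fun l => ?_
    induction l using Fin.lastCases with
    | last => rw [Fin.succ_last, hd']; exact le_top
    | cast l =>
      rw [← Fin.castSucc_succ, hd, hd]
      exact Submodule.map_mono (hc (Fin.castSucc_le_succ l))
  · rw [← Fin.castSucc_zero, hd, h0, Submodule.map_bot]
  · intro l
    induction l using Fin.lastCases with
    | last =>
      rw [Fin.succ_last, hd', hd, h1, Submodule.map_top, ← hfg]
      exact ⟨j, g ∘ₗ Submodule.subtype ⊤, fun x => (hg x).imp' (fun y => ⟨y, trivial⟩) fun _ h => h,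
        fun _ => Iff.rfl⟩
    | cast l =>
      obtain ⟨i, q, hq, hk⟩ := hq l
      rw [← Fin.castSucc_succ, hd, hd]
      exact ⟨i, exists_quotient_map_of_injective f hf q hq hk⟩

theorem InFilt.of_exact (f : A →ₗ[R] B) (g : B →ₗ[R] D) (hf : Function.Injective f)
    (hg : Function.Surjective g) (hfg : LinearMap.ker g = LinearMap.range f)
    (hA : InFilt Δ (ModuleCat.of R A)) (hD : InFilt Δ (ModuleCat.of R D)) :
    InFilt Δ (ModuleCat.of R B) := by
  obtain ⟨m, c, hc, h0, h1, hq⟩ := inFilt_iff.1 hD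
  have key (l : Fin (m + 1)) : InFilt Δ (ModuleCat.of R ((c l).comap g)) := by
    induction l using Fin.induction with
    | zero =>
      have : (c 0).comap g = LinearMap.range f := by rw [h0, ← hfg]; rfl
      exact .of_linearEquiv (.trans (.ofInjective f hf) (.ofEq _ _ this.symm)) hA
    | succ l ih =>
      obtain ⟨j, q, hq, hk⟩ := hq l
      have hle : (c l.castSucc).comap g ≤ (c l.succ).comap g :=
        Submodule.comap_mono (hc (Fin.castSucc_le_succ l))
      let g' : (c l.succ).comap g →ₗ[R] c l.succ := g.restrict fun _ h => h
      refine .of_standard_quotient (j := j) (Submodule.inclusion hle) (q ∘ₗ g')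
        (Submodule.inclusion_injective hle) (hq.comp fun y => ?_) ?_ ih
      · obtain ⟨x, hx⟩ := hg y
        exact ⟨⟨x, by simp [hx]⟩, Subtype.ext hx⟩
      · ext x
        rw [Submodule.range_inclusion]
        exact hk (g' x)
  have htop : (c (Fin.last m)).comap g = ⊤ := by rw [h1, Submodule.comap_top]
  exact .of_linearEquiv (.ofTop _ htop) (key (Fin.last m))

end

theorem endomorphism_algebra_strongly_quasihereditary
    (k : Type v) [Field k] (𝒜 : Type u) [Category.{v} 𝒜] [Abelian 𝒜]
    [CategoryTheory.Linear k 𝒜]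
    (C : Set 𝒜)
    (hfin : ∀ X Y : 𝒜, X ∈ C → Y ∈ C → FiniteDimensional k (X ⟶ Y))
    (hext : ∀ S : ShortComplex 𝒜, S.ShortExact → S.X₁ ∈ C → S.X₃ ∈ C → S.X₂ ∈ C)
    (n : ℕ) (Mi : Fin n → 𝒜) (M : 𝒜) (hM : M ∈ C) (isoM : M ≅ ⨁ Mi)
    (hind : ∀ i, Indecomposable (Mi i))
    (hpair : ∀ i j, i ≠ j → IsEmpty (Mi i ≅ Mi j))
    (hrigid : ∀ (E : 𝒜), E ∈ C → ∀ (f : M ⟶ E) (g : E ⟶ M) (w : f ≫ g = 0),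
      (ShortComplex.mk f g w).ShortExact → ∃ s : M ⟶ E, s ≫ g = 𝟙 M)
    (Mi' : Fin n → 𝒜) (f : ∀ i, Mi i ⟶ Mi' i)
    (htarget : ∀ i, BelowAdd Mi i (Mi' i))
    (happrox : ∀ i (X : 𝒜), BelowAdd Mi i X → ∀ g : Mi i ⟶ X, ∃ h : Mi' i ⟶ X, f i ≫ h = g)
    (hmin : ∀ i (g : Mi' i ⟶ Mi' i), f i ≫ g = f i → IsIso g)
    (hsurj : ∀ i, Epi (f i))
    -- Γ = End_C(M) has finite global dimension :
    (hgl : ∃ d, ∀ D : ModuleCat.{v} (End M), pdLE (End M) d D) :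
    -- the Δᵢ = Hom_C(Ker fᵢ, M) are the standard modules w.r.t. the ordering
    -- Hom(Mₙ,M),…,Hom(M₁,M) : the kernel of the canonical surjection Pᵢ → Δᵢ is the
    -- trace of the projectives Pⱼ, j < i :
    (∀ i : Fin n, LinearMap.ker (preMap (M := M) (kernel.ι (f i))) =
        ⨆ (j : Fin n) (_ : j < i) (φ : (Mi j ⟶ M) →ₗ[End M] (Mi i ⟶ M)),
          LinearMap.range φ) ∧
    -- Γ is quasihereditary : every indecomposable projective Pᵢ = Hom_C(Mᵢ, M) is
    -- filtered by the standard modules Δⱼ :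
    (∀ i : Fin n, InFilt (fun j => ModuleCat.of (End M) (kernel (f j) ⟶ M))
        (ModuleCat.of (End M) (Mi i ⟶ M))) ∧
    -- Γ is left strongly quasihereditary : pd Δᵢ ≤ 1 :
    (∀ i : Fin n, pdLE (End M) 1 (ModuleCat.of (End M) (kernel (f i) ⟶ M))) := by
  have hret (i : Fin n) : Retract (Mi i) M :=
    { i := biproduct.ι Mi i ≫ isoM.inv
      r := isoM.hom ≫ biproduct.π Mi i }
  have := hfin M M hM hM
  have (i j : Fin n) : Module.Finite k (Mi i ⟶ Mi j) :=
    module_finite_hom_of_retract k (hret i) (hret j)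
  have hadd (i : Fin n) : ∃ m : ℕ, Nonempty (Retract (Mi' i)
      (⨁ fun q : Fin m × {j : Fin n // j < i} => Mi q.2.1)) := by
    obtain ⟨m, s, r, h⟩ := htarget i
    exact ⟨m, ⟨⟨s, r, h⟩⟩⟩
  have hS (i : Fin n) :
      (ShortComplex.mk (kernel.ι (f i)) (f i) (kernel.condition (f i))).ShortExact :=
    { exact := ShortComplex.exact_of_f_is_kernel _ (kernelIsKernel (f i))
      epi_g := hsurj i }
  have hker (i : Fin n) : LinearMap.ker (preMap (M := M) (kernel.ι (f i))) =
      LinearMap.range (preMap (M := M) (f i)) := (hS i).ker_preMap M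
  have hinj (i : Fin n) : Function.Injective (preMap (M := M) (f i)) := preMap_injective (f i)
  have hsur (i : Fin n) : Function.Surjective (preMap (M := M) (kernel.ι (f i))) := fun φ => by
    refine (hS i).exists_desc_of_forall_section (fun E a b w hE => ?_) φ
    obtain ⟨m, ⟨h⟩⟩ := hadd i
    exact exists_section_of_retract_biproduct (fun q : Fin m × {j : Fin n // j < i} => ⟨hret q.2.1⟩) h b fun x =>
      hE.exists_lift_of_forall_section
        (fun E' a' b' w' hE' => hrigid E' (hext _ hE' hM hM) a' b' w' hE') x
  have := projective_hom_self M
  have hproj (i : Fin n) : Module.Projective (End M) (Mi i ⟶ M) := projective_hom_of_retract (hret i)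
  refine ⟨fun i => ?_, fun i => ?_, fun i => ?_⟩
  · apply le_antisymm
    · rw [hker]
      rintro _ ⟨ψ, rfl⟩
      obtain ⟨m, ⟨h⟩⟩ := hadd i
      let Y : Fin m × {j : Fin n // j < i} → 𝒜 := fun q => Mi q.2.1
      have : preMap (f i) ψ =
          ∑ q, preMap (f i ≫ h.i ≫ biproduct.π Y q) (biproduct.ι Y q ≫ h.r ≫ ψ) := by
        change f i ≫ ψ = ∑ q, (f i ≫ h.i ≫ biproduct.π Y q) ≫ biproduct.ι Y q ≫ h.r ≫ ψ
        have hsum : ∑ q, (h.i ≫ biproduct.π Y q) ≫ biproduct.ι Y q ≫ h.r = 𝟙 (Mi' i) :=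
          h.sum_comp_eq_id
        trans f i ≫ 𝟙 (Mi' i) ≫ ψ
        · simp
        · rw [← hsum, Preadditive.sum_comp, Preadditive.comp_sum]
          simp
      rw [this]
      refine sum_mem fun q _ => ?_
      exact (le_iSup₂_of_le q.2.1 q.2.2 (le_iSup (fun φ => LinearMap.range φ) _) :
        LinearMap.range (preMap (f i ≫ h.i ≫ biproduct.π Y q)) ≤ _) ⟨_, rfl⟩
    · refine iSup₂_le fun j hj => iSup_le fun φ => ?_
      obtain ⟨g, rfl⟩ := exists_eq_preMap (hret j) φ
      obtain ⟨h, rfl⟩ := happrox i (Mi j) ⟨1, biproduct.ι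
        (fun q : Fin 1 × {j : Fin n // j < i} => Mi q.2.1) (0, ⟨j, hj⟩),
        biproduct.π (fun q : Fin 1 × {j : Fin n // j < i} => Mi q.2.1) (0, ⟨j, hj⟩),
        biproduct.ι_π_self _ _⟩ g
      rintro _ ⟨ψ, rfl⟩
      change kernel.ι (f i) ≫ (f i ≫ h) ≫ ψ = 0
      simp
  · induction i using WellFoundedLT.induction with
    | ind i ih =>
      obtain ⟨m, ⟨h⟩⟩ := hadd i
      let P : ObjectProperty 𝒜 := fun X =>
        InFilt (fun j => ModuleCat.of (End M) (kernel (f j) ⟶ M)) (ModuleCat.of (End M) (X ⟶ M))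
      have : P.IsClosedUnderIsomorphisms := ⟨fun {X Y} e hX => hX.of_linearEquiv
        (.ofLinearMap (preMap e.inv) (preMap e.hom)
          (LinearMap.ext e.inv_hom_id_assoc) (LinearMap.ext e.hom_inv_id_assoc))⟩
      have hP : P (Mi' i) := by
        refine retract_biproduct_induction k
          (fun q : Fin m × {j : Fin n // j < i} => Mi q.2.1) (fun q => hind q.2.1) P
          (fun X hX => ?_) (fun A B hA hB => ?_) (fun q => ih q.2.1 q.2.2) h
        · have : Subsingleton (X ⟶ M) := ⟨hX.eq_of_src⟩
          exact .of_subsingleton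
        · have hs : (ShortComplex.mk (biprod.inl : A ⟶ A ⊞ B) biprod.snd biprod.inl_snd).Exact :=
            (ShortComplex.Splitting.ofHasBinaryBiproduct A B).exact
          exact .of_exact (preMap biprod.snd) (preMap biprod.inl) (preMap_injective _)
            (fun φ => ⟨biprod.desc φ 0, biprod.inl_desc _ _⟩)
            (ShortComplex.ShortExact.ker_preMap ⟨hs⟩ M) hB hA
      exact .of_standard_quotient (j := i) (preMap (f i)) (preMap (kernel.ι (f i))) (hinj i)
        (hsur i) (hker i) hP
  · refine ⟨ModuleCat.of (End M) (Mi i ⟶ M), preMap (kernel.ι (f i)), hproj i, hsur i, ?_⟩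
    change Module.Projective (End M) (LinearMap.ker (preMap (M := M) (kernel.ι (f i))))
    obtain ⟨m, ⟨h⟩⟩ := hadd i
    have := projective_hom_biproduct (M := M)
      fun q : Fin m × {j : Fin n // j < i} => Mi q.2.1
    have := projective_hom_of_retract (M := M) h
    exact .of_equiv ((LinearEquiv.ofInjective _ (hinj i)).trans (.ofEq _ _ (hker i).symm))
end

section
/- Let A be a finite-dimensional algebra with id_A A ≤ 1 and M a cluster tilting object in Sub A. Then the syzygy functor Ω induces that Ω̃M = A ⊕ ΩM is again a cluster tilting object in Sub A, and the stable endomorphism algebras of M and ΩM are isomorphic. -/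
/-!
STATEMENT 9. Let A be a finite-dimensional algebra with id_A A ≤ 1 and M a cluster
tilting object in Sub A.  Then Ω̃M = A ⊕ ΩM is again a cluster tilting object in Sub A
(ΩM the syzygy with respect to a projective cover p : P → M), and the stable
endomorphism algebras of M and of ΩM are isomorphic.
-/

def Ext1Zero (A : Type) [Ring A] (Z X : Type) [AddCommGroup Z] [Module A Z]
    [AddCommGroup X] [Module A X] : Prop :=
  ∀ (E : Type) [AddCommGroup E] [Module A E] (f : X →ₗ[A] E) (g : E →ₗ[A] Z),
    Function.Injective f → Function.Surjective g → LinearMap.range f = LinearMap.ker g →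
    ∃ s : Z →ₗ[A] E, g ∘ₗ s = LinearMap.id

def InSub (A : Type) [Ring A] (X : Type) [AddCommGroup X] [Module A X] : Prop :=
  ∃ (n : ℕ) (f : X →ₗ[A] (Fin n → A)), Function.Injective f

def InAdd (A : Type) [Ring A] (M X : Type) [AddCommGroup M] [Module A M]
    [AddCommGroup X] [Module A X] : Prop :=
  ∃ (n : ℕ) (s : X →ₗ[A] (Fin n → M)) (r : (Fin n → M) →ₗ[A] X), r ∘ₗ s = LinearMap.id

def IsClusterTilting (A : Type) [Ring A] (M : Type) [AddCommGroup M] [Module A M] : Prop :=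
  InSub A M ∧
  ∀ (X : Type) [AddCommGroup X] [Module A X], InSub A X →
    ((Ext1Zero A M X ↔ InAdd A M X) ∧ (Ext1Zero A X M ↔ InAdd A M X))

def InjDimLE1 (A : Type) [Ring A] : Prop :=
  ∃ (I₀ : ModuleCat.{0} A) (ι : A →ₗ[A] I₀), Module.Injective A I₀ ∧
    Function.Injective ι ∧ Module.Injective A (I₀ ⧸ LinearMap.range ι)

/-- The two-sided ideal of `End_A(M)` of endomorphisms factoring through a projective. -/
def projIdeal (A : Type) [Ring A] (M : Type) [AddCommGroup M] [Module A M] :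
    TwoSidedIdeal (Module.End A M) :=
  TwoSidedIdeal.span {f : Module.End A M | ∃ (Q : ModuleCat.{0} A), Module.Projective A Q ∧
    ∃ (a : M →ₗ[A] Q) (b : Q →ₗ[A] M), f = b ∘ₗ a}

/-- The stable endomorphism algebra `End(M)/{maps factoring through projectives}`. -/
def StableEnd (A : Type) [Ring A] (M : Type) [AddCommGroup M] [Module A M] : Type :=
  (projIdeal A M).ringCon.Quotient

noncomputable instance (A : Type) [Ring A] (M : Type) [AddCommGroup M] [Module A M] :
    Ring (StableEnd A M) := by unfold StableEnd; infer_instance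

section Factorization

variable {A : Type} [Ring A] {X Y Z : Type} [AddCommGroup X] [AddCommGroup Y] [AddCommGroup Z]
  [Module A X] [Module A Y] [Module A Z]

theorem exists_comp_eq_of_ker_le {g : X →ₗ[A] Y} (hg : Function.Surjective g) {h : X →ₗ[A] Z}
    (hk : LinearMap.ker g ≤ LinearMap.ker h) : ∃ h' : Y →ₗ[A] Z, h' ∘ₗ g = h := by
  refine ⟨(LinearMap.ker g).liftQ h hk ∘ₗ (g.quotKerEquivOfSurjective hg).symm.toLinearMap, ?_⟩
  ext x
  have : (g.quotKerEquivOfSurjective hg).symm (g x) = Submodule.Quotient.mk x := by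
    rw [LinearEquiv.symm_apply_eq]; rfl
  simp [this]

theorem exists_comp_eq_of_range_le {f : Y →ₗ[A] Z} (hf : Function.Injective f) {h : X →ₗ[A] Z}
    (hr : LinearMap.range h ≤ LinearMap.range f) : ∃ h' : X →ₗ[A] Y, f ∘ₗ h' = h := by
  refine ⟨(LinearEquiv.ofInjective f hf).symm.toLinearMap ∘ₗ
    h.codRestrict (LinearMap.range f) fun x => hr ⟨x, rfl⟩, ?_⟩
  ext x
  have := congrArg Subtype.val ((LinearEquiv.ofInjective f hf).apply_symm_apply
    (h.codRestrict (LinearMap.range f) (fun x => hr ⟨x, rfl⟩) x))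
  exact this

theorem exists_retract_fin_of_projective (Q : Type) [AddCommGroup Q] [Module A Q]
    [Module.Finite A Q] [Module.Projective A Q] :
    ∃ (n : ℕ) (s : Q →ₗ[A] (Fin n → A)) (r : (Fin n → A) →ₗ[A] Q), r ∘ₗ s = LinearMap.id := by
  obtain ⟨n, r, hr⟩ := Module.Finite.exists_fin' A Q
  obtain ⟨s, hs⟩ := Module.projective_lifting_property r LinearMap.id hr
  exact ⟨n, s, r, hs⟩

end Factorization

section InSub

variable {A : Type} [Ring A] {X Y Z : Type} [AddCommGroup X] [AddCommGroup Y] [AddCommGroup Z]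
  [Module A X] [Module A Y] [Module A Z]

theorem InSub.of_injective (hY : InSub A Y) (f : X →ₗ[A] Y) (hf : Function.Injective f) :
    InSub A X := by
  obtain ⟨n, g, hg⟩ := hY
  exact ⟨n, g ∘ₗ f, hg.comp hf⟩

theorem InSub.prod (hX : InSub A X) (hY : InSub A Y) : InSub A (X × Y) := by
  obtain ⟨n, f, hf⟩ := hX
  obtain ⟨m, g, hg⟩ := hY
  let e := (LinearEquiv.sumArrowLequivProdArrow (Fin n) (Fin m) A A).symm.trans
    (LinearEquiv.funCongrLeft A A finSumFinEquiv.symm)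
  exact ⟨n + m, e.toLinearMap ∘ₗ f.prodMap g, e.injective.comp (hf.prodMap hg)⟩

theorem InSub.pi (hX : InSub A X) (m : ℕ) : InSub A (Fin m → X) := by
  obtain ⟨n, f, hf⟩ := hX
  let e := (LinearEquiv.curry A A (Fin m) (Fin n)).symm.trans
    (LinearEquiv.funCongrLeft A A finProdFinEquiv.symm)
  refine ⟨m * n, e.toLinearMap ∘ₗ f.compLeft (Fin m), e.injective.comp fun a b h => ?_⟩
  funext i
  exact hf (congrFun h i)

theorem inSub_of_projective (Q : Type) [AddCommGroup Q] [Module A Q]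
    [Module.Finite A Q] [Module.Projective A Q] : InSub A Q := by
  obtain ⟨n, s, r, h⟩ := exists_retract_fin_of_projective (A := A) Q
  exact ⟨n, s, Function.LeftInverse.injective (g := r) fun x => LinearMap.congr_fun h x⟩

theorem InSub.exists_extension_to_ring (hid : InjDimLE1 A) (hZ : InSub A Z)
    (f : X →ₗ[A] Y) (g : Y →ₗ[A] Z) (hf : Function.Injective f)
    (hfg : LinearMap.range f = LinearMap.ker g) (h : X →ₗ[A] A) :
    ∃ h' : Y →ₗ[A] A, h' ∘ₗ f = h := by
  obtain ⟨I, ι, hI, hι, hI'⟩ := hid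
  obtain ⟨n, j, hj⟩ := hZ
  obtain ⟨u, hu⟩ := hI.out f hf (ι ∘ₗ h)
  let q := (LinearMap.range ι).mkQ
  have hker : LinearMap.ker g.rangeRestrict ≤ LinearMap.ker (q ∘ₗ u) := by
    rw [LinearMap.ker_rangeRestrict, ← hfg]
    rintro _ ⟨x, rfl⟩
    simp [q, hu]
  obtain ⟨v, hv⟩ := exists_comp_eq_of_ker_le g.surjective_rangeRestrict hker
  obtain ⟨w, hw⟩ := hI'.out (j ∘ₗ (LinearMap.range g).subtype)
    (hj.comp Subtype.val_injective) v
  obtain ⟨t, ht⟩ := Module.projective_lifting_property q w (Submodule.mkQ_surjective _)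
  obtain ⟨h', hh'⟩ := exists_comp_eq_of_range_le hι (h := u - t ∘ₗ j ∘ₗ g) (by
    rintro _ ⟨y, rfl⟩
    rw [← Submodule.ker_mkQ (LinearMap.range ι), LinearMap.mem_ker]
    have h1 : q (t (j (g y))) = w (j (g y)) := LinearMap.congr_fun ht _
    have h2 : w (j (g y)) = v (g.rangeRestrict y) := hw (g.rangeRestrict y)
    have h3 : v (g.rangeRestrict y) = q (u y) := LinearMap.congr_fun hv y
    change q (u y - t (j (g y))) = 0
    rw [map_sub, h1, h2, h3, sub_self])
  refine ⟨h', ?_⟩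
  ext x
  apply hι
  have h1 := LinearMap.congr_fun hh' (f x)
  have h2 : g (f x) = 0 := by
    have : f x ∈ LinearMap.ker g := hfg ▸ ⟨x, rfl⟩
    exact this
  simpa [h2, hu] using h1

theorem InSub.exists_extension (hid : InjDimLE1 A) (hZ : InSub A Z)
    {Q : Type} [AddCommGroup Q] [Module A Q] [Module.Finite A Q] [Module.Projective A Q]
    (f : X →ₗ[A] Y) (g : Y →ₗ[A] Z) (hf : Function.Injective f)
    (hfg : LinearMap.range f = LinearMap.ker g) (h : X →ₗ[A] Q) :
    ∃ h' : Y →ₗ[A] Q, h' ∘ₗ f = h := by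
  obtain ⟨n, s, r, hrs⟩ := exists_retract_fin_of_projective (A := A) Q
  choose h' hh' using fun i : Fin n =>
    hZ.exists_extension_to_ring hid f g hf hfg (LinearMap.proj i ∘ₗ s ∘ₗ h)
  refine ⟨r ∘ₗ LinearMap.pi h', ?_⟩
  have : LinearMap.pi h' ∘ₗ f = s ∘ₗ h := by
    ext x i
    exact LinearMap.congr_fun (hh' i) x
  rw [LinearMap.comp_assoc, this, ← LinearMap.comp_assoc, hrs, LinearMap.id_comp]

end InSub

section Ext1Zero

variable {A : Type} [Ring A] {K P Z X J Y : Type}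
  [AddCommGroup K] [AddCommGroup P] [AddCommGroup Z]
  [AddCommGroup X] [AddCommGroup J] [AddCommGroup Y]
  [Module A K] [Module A P] [Module A Z] [Module A X] [Module A J] [Module A Y]

theorem ext1Zero_iff_forall_exists_extension [Module.Projective A P]
    {i : K →ₗ[A] P} {π : P →ₗ[A] Z} (hi : Function.Injective i) (hπ : Function.Surjective π)
    (hiπ : LinearMap.range i = LinearMap.ker π) :
    Ext1Zero A Z X ↔ ∀ h : K →ₗ[A] X, ∃ h' : P →ₗ[A] X, h' ∘ₗ i = h := by
  have hπi : ∀ x, π (i x) = 0 := fun x => by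
    have : i x ∈ LinearMap.ker π := hiπ ▸ ⟨x, rfl⟩
    exact this
  constructor
  · intro hE h
    let N := LinearMap.range (h.prod (-i))
    let f : X →ₗ[A] (X × P) ⧸ N := N.mkQ ∘ₗ LinearMap.inl A X P
    let u : P →ₗ[A] (X × P) ⧸ N := N.mkQ ∘ₗ LinearMap.inr A X P
    let g : (X × P) ⧸ N →ₗ[A] Z := N.liftQ (π ∘ₗ LinearMap.snd A X P) (by
      rintro _ ⟨x, rfl⟩
      simp [hπi])
    have hf : Function.Injective f := by
      rw [← LinearMap.ker_eq_bot, LinearMap.ker_eq_bot']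
      intro x hx
      obtain ⟨y, hy⟩ : (x, (0 : P)) ∈ N := (Submodule.Quotient.mk_eq_zero N).1 hx
      have hy1 : h y = x := congrArg Prod.fst hy
      have hy2 : -i y = 0 := congrArg Prod.snd hy
      have : y = 0 := hi (by simpa using hy2)
      rw [← hy1, this, map_zero]
    have hfu : ∀ x, f (h x) = u (i x) := by
      intro x
      refine (Submodule.Quotient.eq N).2 ⟨x, ?_⟩
      simp
    have hfg : LinearMap.range f = LinearMap.ker g := by
      apply le_antisymm
      · rintro _ ⟨x, rfl⟩
        change π 0 = 0
        exact map_zero _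
      · intro e he
        obtain ⟨⟨x, y⟩, rfl⟩ := N.mkQ_surjective e
        have hy : y ∈ LinearMap.range i := hiπ ▸ (he : π y = 0)
        obtain ⟨z, rfl⟩ := hy
        refine ⟨x + h z, ?_⟩
        rw [map_add, hfu]
        change N.mkQ (x, 0) + N.mkQ (0, i z) = _
        rw [← map_add]
        simp
    obtain ⟨s, hs⟩ := hE _ f g hf (fun z => by
      obtain ⟨y, rfl⟩ := hπ z
      exact ⟨u y, rfl⟩) hfg
    obtain ⟨h', hh'⟩ := exists_comp_eq_of_range_le hf (h := u - s ∘ₗ π) (by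
      rw [hfg]
      rintro _ ⟨y, rfl⟩
      have h1 : g (s (π y)) = π y := LinearMap.congr_fun hs (π y)
      have h2 : g (u y) = π y := rfl
      simp [h1, h2])
    refine ⟨h', ?_⟩
    ext x
    apply hf
    have := LinearMap.congr_fun hh' (i x)
    simpa [hπi, hfu] using this
  · intro H E _ _ f g hf hg hfg
    obtain ⟨q, hq⟩ := Module.projective_lifting_property g π hg
    obtain ⟨h, hh⟩ := exists_comp_eq_of_range_le hf (h := q ∘ₗ i) (by
      rw [hfg]
      rintro _ ⟨x, rfl⟩
      have := LinearMap.congr_fun hq (i x)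
      simpa [hπi] using this)
    obtain ⟨h', hh'⟩ := H h
    obtain ⟨s, hs⟩ := exists_comp_eq_of_ker_le hπ (h := q - f ∘ₗ h') (by
      rw [← hiπ]
      rintro _ ⟨x, rfl⟩
      have h1 := LinearMap.congr_fun hh' x
      have h2 := LinearMap.congr_fun hh x
      simp only [LinearMap.comp_apply] at h1 h2
      simp [h1, h2])
    refine ⟨s, ?_⟩
    ext z
    obtain ⟨y, rfl⟩ := hπ z
    have h1 := LinearMap.congr_fun hs y
    have h2 := LinearMap.congr_fun hq y
    have h3 : g (f (h' y)) = 0 := by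
      have : f (h' y) ∈ LinearMap.ker g := hfg ▸ ⟨_, rfl⟩
      exact this
    simp only [LinearMap.comp_apply] at h1 h2
    simp [h1, h2, h3]

theorem ext1Zero_of_projective [Module.Projective A Z] : Ext1Zero A Z X :=
  fun _ _ _ _ g _ hg _ => Module.projective_lifting_property g LinearMap.id hg

theorem ext1Zero_iff_forall_exists_lift [Module.Finite A J] [Module.Projective A J]
    (hid : InjDimLE1 A) (hZ : InSub A Z)
    {f : X →ₗ[A] J} {g : J →ₗ[A] Y} (hf : Function.Injective f) (hg : Function.Surjective g)
    (hfg : LinearMap.range f = LinearMap.ker g) :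
    Ext1Zero A Z X ↔ ∀ h : Z →ₗ[A] Y, ∃ h' : Z →ₗ[A] J, g ∘ₗ h' = h := by
  have hgf : ∀ x, g (f x) = 0 := fun x => by
    have : f x ∈ LinearMap.ker g := hfg ▸ ⟨x, rfl⟩
    exact this
  constructor
  · intro hE h
    let E := LinearMap.eqLocus (g ∘ₗ LinearMap.fst A J Z) (h ∘ₗ LinearMap.snd A J Z)
    let f' : X →ₗ[A] E := (LinearMap.inl A J Z ∘ₗ f).codRestrict E fun x => by
      simp [E, hgf]
    let g' : E →ₗ[A] Z := LinearMap.snd A J Z ∘ₗ E.subtype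
    obtain ⟨s, hs⟩ := hE E f' g' (fun x y hxy => hf (congrArg (fun e : E => e.1.1) hxy))
      (fun z => by
        obtain ⟨y, hy⟩ := hg (h z)
        exact ⟨⟨(y, z), hy⟩, rfl⟩)
      (by
        apply le_antisymm
        · rintro _ ⟨x, rfl⟩
          rfl
        · rintro ⟨⟨y, z⟩, hyz⟩ hz
          obtain rfl : z = 0 := hz
          have hyz' : g y = h 0 := hyz
          rw [map_zero] at hyz'
          have hy : y ∈ LinearMap.range f := hfg ▸ hyz'
          obtain ⟨x, rfl⟩ := hy
          exact ⟨x, rfl⟩)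
    refine ⟨LinearMap.fst A J Z ∘ₗ E.subtype ∘ₗ s, ?_⟩
    ext z
    have h1 : g (s z).1.1 = h (s z).1.2 := (s z).2
    have h2 : (s z).1.2 = z := LinearMap.congr_fun hs z
    simpa [h2] using h1
  · intro H E _ _ f' g' hf' hg' hfg'
    have hgf' : ∀ x, g' (f' x) = 0 := fun x => by
      have : f' x ∈ LinearMap.ker g' := hfg' ▸ ⟨x, rfl⟩
      exact this
    obtain ⟨u, hu⟩ := hZ.exists_extension hid f' g' hf' hfg' f
    obtain ⟨v, hv⟩ := exists_comp_eq_of_ker_le hg' (h := g ∘ₗ u) (by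
      rw [← hfg']
      rintro _ ⟨x, rfl⟩
      have := LinearMap.congr_fun hu x
      simp only [LinearMap.comp_apply] at this
      simp [this, hgf])
    obtain ⟨w, hw⟩ := H v
    obtain ⟨r, hr⟩ := exists_comp_eq_of_range_le hf (h := u - w ∘ₗ g') (by
      rw [hfg]
      rintro _ ⟨e, rfl⟩
      have h1 := LinearMap.congr_fun hv e
      have h2 := LinearMap.congr_fun hw (g' e)
      simp only [LinearMap.comp_apply] at h1 h2
      simp [h1, h2])
    have hrf : ∀ x, r (f' x) = x := fun x => by
      apply hf
      have h1 := LinearMap.congr_fun hr (f' x)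
      have h2 := LinearMap.congr_fun hu x
      simp only [LinearMap.comp_apply] at h2
      simpa [hgf', h2] using h1
    obtain ⟨s, hs⟩ := exists_comp_eq_of_ker_le hg' (h := LinearMap.id - f' ∘ₗ r) (by
      rw [← hfg']
      rintro _ ⟨x, rfl⟩
      simp [hrf])
    refine ⟨s, ?_⟩
    ext z
    obtain ⟨e, rfl⟩ := hg' z
    have h1 := LinearMap.congr_fun hs e
    simp only [LinearMap.comp_apply] at h1
    simp [h1, hgf']

theorem ext1Zero_shift_iff [Module.Finite A J] [Module.Projective A J] [Module.Projective A P]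
    (hid : InjDimLE1 A) (hK : InSub A K) (hZ : InSub A Z)
    {i : K →ₗ[A] P} {π : P →ₗ[A] Z} (hi : Function.Injective i) (hπ : Function.Surjective π)
    (hiπ : LinearMap.range i = LinearMap.ker π)
    {f : X →ₗ[A] J} {g : J →ₗ[A] Y} (hf : Function.Injective f) (hg : Function.Surjective g)
    (hfg : LinearMap.range f = LinearMap.ker g) :
    Ext1Zero A K X ↔ Ext1Zero A Z Y := by
  rw [ext1Zero_iff_forall_exists_lift hid hK hf hg hfg,
    ext1Zero_iff_forall_exists_extension hi hπ hiπ]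
  refine forall_congr' fun h => ⟨?_, ?_⟩
  · rintro ⟨u, rfl⟩
    obtain ⟨v, rfl⟩ := hZ.exists_extension hid i π hi hiπ u
    exact ⟨g ∘ₗ v, rfl⟩
  · rintro ⟨u, rfl⟩
    obtain ⟨v, rfl⟩ := Module.projective_lifting_property g u hg
    exact ⟨v ∘ₗ i, rfl⟩

theorem ext1Zero_prod_left_iff [Module.Projective A P] :
    Ext1Zero A (P × Z) X ↔ Ext1Zero A Z X := by
  let F := Z →₀ A
  let q : F →ₗ[A] Z := Finsupp.linearCombination A id
  have hq : Function.Surjective q := Finsupp.linearCombination_id_surjective A Z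
  let i : LinearMap.ker q →ₗ[A] F := (LinearMap.ker q).subtype
  have hi : Function.Injective i := Subtype.val_injective
  rw [ext1Zero_iff_forall_exists_extension (K := LinearMap.ker q) (i := i) hi hq
      (Submodule.range_subtype _),
    ext1Zero_iff_forall_exists_extension (K := LinearMap.ker q) (i := LinearMap.inr A P F ∘ₗ i)
      (π := (LinearMap.id : P →ₗ[A] P).prodMap q)
      (LinearMap.inr_injective.comp (f := i) hi) (Function.surjective_id.prodMap hq)]
  · refine forall_congr' fun h => ⟨?_, ?_⟩
    · rintro ⟨u, rfl⟩
      exact ⟨u ∘ₗ LinearMap.inr A P F, rfl⟩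
    · rintro ⟨u, rfl⟩
      refine ⟨u ∘ₗ LinearMap.snd A P F, ?_⟩
      ext x
      simp
  · ext ⟨x, y⟩
    constructor
    · rintro ⟨z, hz⟩
      have h1 : 0 = x := congrArg Prod.fst hz
      have h2 : z.1 = y := congrArg Prod.snd hz
      subst h1 h2
      exact Prod.ext rfl z.2
    · intro h
      have h1 : x = 0 := congrArg Prod.fst h
      have h2 : q y = 0 := congrArg Prod.snd h
      exact ⟨⟨y, h2⟩, by rw [h1]; rfl⟩

theorem ext1Zero_prod_right_iff [Module.Finite A J] [Module.Projective A J]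
    (hid : InjDimLE1 A) (hZ : InSub A Z) :
    Ext1Zero A Z (J × X) ↔ Ext1Zero A Z X := by
  let F := Z →₀ A
  let q : F →ₗ[A] Z := Finsupp.linearCombination A id
  have hq : Function.Surjective q := Finsupp.linearCombination_id_surjective A Z
  let i : LinearMap.ker q →ₗ[A] F := (LinearMap.ker q).subtype
  have hi : Function.Injective i := Subtype.val_injective
  have hiq : LinearMap.range i = LinearMap.ker q := Submodule.range_subtype _
  rw [ext1Zero_iff_forall_exists_extension (K := LinearMap.ker q) (i := i) (π := q) hi hq hiq,
    ext1Zero_iff_forall_exists_extension (K := LinearMap.ker q) (i := i) (π := q) hi hq hiq]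
  constructor
  · intro H h
    obtain ⟨u, hu⟩ := H (LinearMap.inr A J X ∘ₗ h)
    exact ⟨LinearMap.snd A J X ∘ₗ u, by rw [LinearMap.comp_assoc, hu]; rfl⟩
  · intro H h
    obtain ⟨u, hu⟩ := H (LinearMap.snd A J X ∘ₗ h)
    obtain ⟨v, hv⟩ := hZ.exists_extension (X := LinearMap.ker q) hid i q hi hiq
      (LinearMap.fst A J X ∘ₗ h)
    refine ⟨v.prod u, ?_⟩
    apply LinearMap.ext
    intro x
    exact Prod.ext (LinearMap.congr_fun hv x) (LinearMap.congr_fun hu x)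

end Ext1Zero

section InAdd

variable {A : Type} [Ring A] {M X Y : Type} [AddCommGroup M] [AddCommGroup X] [AddCommGroup Y]
  [Module A M] [Module A X] [Module A Y]

theorem InAdd.of_fintype {ι : Type} [Fintype ι] (s : X →ₗ[A] (ι → M)) (r : (ι → M) →ₗ[A] X)
    (h : r ∘ₗ s = LinearMap.id) : InAdd A M X := by
  let e := LinearEquiv.funCongrLeft A M (Fintype.equivFin ι).symm
  refine ⟨Fintype.card ι, e.toLinearMap ∘ₗ s, r ∘ₗ e.symm.toLinearMap, ?_⟩
  ext x
  simpa using LinearMap.congr_fun h x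

theorem InAdd.refl : InAdd A M M :=
  .of_fintype (ι := Unit) (LinearMap.pi fun _ => LinearMap.id) (LinearMap.proj ()) rfl

theorem InAdd.of_retract (hY : InAdd A M Y) (s : X →ₗ[A] Y) (r : Y →ₗ[A] X)
    (h : r ∘ₗ s = LinearMap.id) : InAdd A M X := by
  obtain ⟨n, s', r', h'⟩ := hY
  refine ⟨n, s' ∘ₗ s, r ∘ₗ r', ?_⟩
  ext x
  have h1 : r' (s' (s x)) = s x := LinearMap.congr_fun h' _
  have h2 : r (s x) = x := LinearMap.congr_fun h x
  simp [h1, h2]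

theorem InAdd.prod (hX : InAdd A M X) (hY : InAdd A M Y) : InAdd A M (X × Y) := by
  obtain ⟨n, s, r, h⟩ := hX
  obtain ⟨m, s', r', h'⟩ := hY
  let e := LinearEquiv.sumArrowLequivProdArrow (Fin n) (Fin m) A M
  refine .of_fintype (e.symm.toLinearMap ∘ₗ s.prodMap s') (r.prodMap r' ∘ₗ e.toLinearMap) ?_
  apply LinearMap.ext
  rintro ⟨x, y⟩
  have h1 : r (s x) = x := LinearMap.congr_fun h x
  have h2 : r' (s' y) = y := LinearMap.congr_fun h' y
  simp [h1, h2]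

theorem InAdd.pi (hX : InAdd A M X) (m : ℕ) : InAdd A M (Fin m → X) := by
  obtain ⟨n, s, r, h⟩ := hX
  let e := LinearEquiv.curry A M (Fin m) (Fin n)
  refine .of_fintype (e.symm.toLinearMap ∘ₗ s.compLeft (Fin m))
    (r.compLeft (Fin m) ∘ₗ e.toLinearMap) ?_
  apply LinearMap.ext
  intro x
  funext i
  have h1 : r (s (x i)) = x i := LinearMap.congr_fun h _
  simpa [e] using h1

theorem InAdd.of_projective (h : InAdd A M A) (Q : Type) [AddCommGroup Q] [Module A Q]
    [Module.Finite A Q] [Module.Projective A Q] : InAdd A M Q := by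
  obtain ⟨n, s, r, hrs⟩ := exists_retract_fin_of_projective (A := A) Q
  exact (h.pi n).of_retract s r hrs

theorem LinearMap.range_compLeft_eq_ker {K P Z : Type} [AddCommGroup K] [AddCommGroup P]
    [AddCommGroup Z] [Module A K] [Module A P] [Module A Z] {i : K →ₗ[A] P} {π : P →ₗ[A] Z}
    (h : LinearMap.range i = LinearMap.ker π) (n : ℕ) :
    LinearMap.range (i.compLeft (Fin n)) = LinearMap.ker (π.compLeft (Fin n)) := by
  ext x
  have hx : ∀ j, x j ∈ LinearMap.range i ↔ π (x j) = 0 := fun j => by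
    rw [h, LinearMap.mem_ker]
  constructor
  · rintro ⟨y, rfl⟩
    funext j
    exact (hx j).1 ⟨y j, rfl⟩
  · intro H
    choose y hy using fun j => (hx j).2 (congrFun H j)
    exact ⟨y, funext hy⟩

end InAdd

section Shift

variable {A : Type} [Ring A] {K P Z K' P' Z' : Type}
  [AddCommGroup K] [AddCommGroup P] [AddCommGroup Z]
  [AddCommGroup K'] [AddCommGroup P'] [AddCommGroup Z']
  [Module A K] [Module A P] [Module A Z] [Module A K'] [Module A P'] [Module A Z']
  {i : K →ₗ[A] P} {π : P →ₗ[A] Z} {i' : K' →ₗ[A] P'} {π' : P' →ₗ[A] Z'}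

theorem exists_restriction_to_kernels (hi' : Function.Injective i')
    (h : LinearMap.range i = LinearMap.ker π) (h' : LinearMap.range i' = LinearMap.ker π')
    {u : P →ₗ[A] P'} {v : Z →ₗ[A] Z'} (huv : π' ∘ₗ u = v ∘ₗ π) :
    ∃ w : K →ₗ[A] K', i' ∘ₗ w = u ∘ₗ i := by
  refine exists_comp_eq_of_range_le hi' ?_
  rw [h']
  rintro _ ⟨x, rfl⟩
  have h1 : i x ∈ LinearMap.ker π := h ▸ ⟨x, rfl⟩
  have h2 : π' (u (i x)) = v (π (i x)) := LinearMap.congr_fun huv _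
  simpa [LinearMap.mem_ker.1 h1] using h2

theorem exists_map_of_cokernels (hπ : Function.Surjective π)
    (h : LinearMap.range i = LinearMap.ker π) (h' : LinearMap.range i' = LinearMap.ker π')
    {u : P →ₗ[A] P'} {w : K →ₗ[A] K'} (huw : i' ∘ₗ w = u ∘ₗ i) :
    ∃ v : Z →ₗ[A] Z', v ∘ₗ π = π' ∘ₗ u := by
  refine exists_comp_eq_of_ker_le hπ ?_
  rw [← h]
  rintro _ ⟨x, rfl⟩
  have h1 : i' (w x) ∈ LinearMap.ker π' := h' ▸ ⟨_, rfl⟩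
  have h2 : i' (w x) = u (i x) := LinearMap.congr_fun huw _
  simpa [h2] using h1

theorem exists_retract_kernel [Module.Projective A P] [Module.Projective A P']
    (hi : Function.Injective i) (hπ : Function.Surjective π)
    (h : LinearMap.range i = LinearMap.ker π)
    (hi' : Function.Injective i') (hπ' : Function.Surjective π')
    (h' : LinearMap.range i' = LinearMap.ker π')
    (s : Z' →ₗ[A] Z) (r : Z →ₗ[A] Z') (hrs : r ∘ₗ s = LinearMap.id) :
    ∃ (s' : K' →ₗ[A] K × P') (r' : K × P' →ₗ[A] K'), r' ∘ₗ s' = LinearMap.id := by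
  obtain ⟨u, hu⟩ := Module.projective_lifting_property π (s ∘ₗ π') hπ
  obtain ⟨v, hv⟩ := Module.projective_lifting_property π' (r ∘ₗ π) hπ'
  obtain ⟨α, hα⟩ := exists_restriction_to_kernels hi h' h hu
  obtain ⟨β, hβ⟩ := exists_restriction_to_kernels hi' h h' hv
  obtain ⟨γ, hγ⟩ := exists_comp_eq_of_range_le hi' (h := LinearMap.id - v ∘ₗ u) (by
    rw [h']
    rintro _ ⟨x, rfl⟩
    have h1 : π' (v (u x)) = r (π (u x)) := LinearMap.congr_fun hv _
    have h2 : π (u x) = s (π' x) := LinearMap.congr_fun hu _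
    have h3 : r (s (π' x)) = π' x := LinearMap.congr_fun hrs _
    simp [h1, h2, h3])
  refine ⟨α.prod i', β.coprod γ, ?_⟩
  ext x
  apply hi'
  have h1 : i' (β (α x)) = v (i (α x)) := LinearMap.congr_fun hβ _
  have h2 : i (α x) = u (i' x) := LinearMap.congr_fun hα _
  have h3 : i' (γ (i' x)) = i' x - v (u (i' x)) := LinearMap.congr_fun hγ _
  simp [h1, h2, h3]

theorem exists_retract_cokernel [Module.Finite A P] [Module.Finite A P']
    [Module.Projective A P] [Module.Projective A P'] (hid : InjDimLE1 A)
    (hZ : InSub A Z) (hZ' : InSub A Z')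
    (hi : Function.Injective i) (hπ : Function.Surjective π)
    (h : LinearMap.range i = LinearMap.ker π)
    (hi' : Function.Injective i') (hπ' : Function.Surjective π')
    (h' : LinearMap.range i' = LinearMap.ker π')
    (s : K' →ₗ[A] K) (r : K →ₗ[A] K') (hrs : r ∘ₗ s = LinearMap.id) :
    ∃ (s' : Z' →ₗ[A] Z × P') (r' : Z × P' →ₗ[A] Z'), r' ∘ₗ s' = LinearMap.id := by
  obtain ⟨u, hu⟩ := hZ'.exists_extension hid i' π' hi' h' (i ∘ₗ s)
  obtain ⟨v, hv⟩ := hZ.exists_extension hid i π hi h (i' ∘ₗ r)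
  obtain ⟨α, hα⟩ := exists_map_of_cokernels hπ' h' h hu.symm
  obtain ⟨β, hβ⟩ := exists_map_of_cokernels hπ h h' hv.symm
  obtain ⟨γ, hγ⟩ := exists_comp_eq_of_ker_le hπ' (h := LinearMap.id - v ∘ₗ u) (by
    rw [← h']
    rintro _ ⟨x, rfl⟩
    have h1 : v (i (s x)) = i' (r (s x)) := LinearMap.congr_fun hv _
    have h2 : u (i' x) = i (s x) := LinearMap.congr_fun hu _
    have h3 : r (s x) = x := LinearMap.congr_fun hrs _
    simp [h1, h2, h3])
  refine ⟨α.prod γ, β.coprod π', ?_⟩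
  ext z
  obtain ⟨x, rfl⟩ := hπ' z
  have h1 : β (π (u x)) = π' (v (u x)) := LinearMap.congr_fun hβ _
  have h2 : α (π' x) = π (u x) := LinearMap.congr_fun hα _
  have h3 : γ (π' x) = x - v (u x) := LinearMap.congr_fun hγ _
  simp [h1, h2, h3]

end Shift

section StableEnd

variable {A : Type} [Ring A] {M P : Type} [AddCommGroup M] [AddCommGroup P]
  [Module A M] [Module A P]

theorem mem_projIdeal_of_factors {Q : Type} [AddCommGroup Q] [Module A Q] [Module.Projective A Q]
    (a : M →ₗ[A] Q) (b : Q →ₗ[A] M) : b ∘ₗ a ∈ projIdeal A M :=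
  TwoSidedIdeal.subset_span ⟨ModuleCat.of A Q, inferInstance, a, b, rfl⟩

theorem mem_projIdeal_iff_factors_cover [Module.Projective A P] {p : P →ₗ[A] M}
    (hp : Function.Surjective p) (f : Module.End A M) :
    f ∈ projIdeal A M ↔ ∃ b : M →ₗ[A] P, p ∘ₗ b = f := by
  refine ⟨fun hf => ?_, ?_⟩
  · let I : TwoSidedIdeal (Module.End A M) := TwoSidedIdeal.mk' {f | ∃ b : M →ₗ[A] P, p ∘ₗ b = f}
      ⟨0, LinearMap.comp_zero _⟩
      (by
        rintro _ _ ⟨b, rfl⟩ ⟨c, rfl⟩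
        exact ⟨b + c, LinearMap.comp_add ..⟩)
      (by
        rintro _ ⟨b, rfl⟩
        exact ⟨-b, LinearMap.comp_neg ..⟩)
      (by
        rintro x _ ⟨b, rfl⟩
        obtain ⟨y, hy⟩ := Module.projective_lifting_property p (x ∘ₗ p) hp
        exact ⟨y ∘ₗ b, by rw [← LinearMap.comp_assoc, hy]; rfl⟩)
      (by
        rintro _ y ⟨b, rfl⟩
        exact ⟨b ∘ₗ y, rfl⟩)
    have hI : projIdeal A M ≤ I := TwoSidedIdeal.span_le.2 (by
      rintro _ ⟨Q, hQ, a, b, rfl⟩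
      obtain ⟨c, rfl⟩ := Module.projective_lifting_property p b hp
      exact (TwoSidedIdeal.mem_mk' ..).2 ⟨c ∘ₗ a, rfl⟩)
    simpa only [I, TwoSidedIdeal.mem_mk', Set.mem_ofPred_eq] using hI hf
  · rintro ⟨b, rfl⟩
    exact mem_projIdeal_of_factors b p

theorem exists_factorization_fin [Module.Finite A M] {Q N : Type} [AddCommGroup Q] [Module A Q]
    [Module.Projective A Q] [AddCommGroup N] [Module A N] (a : M →ₗ[A] Q) (b : Q →ₗ[A] N) :
    ∃ (n : ℕ) (a' : M →ₗ[A] (Fin n → A)) (b' : (Fin n → A) →ₗ[A] N), b' ∘ₗ a' = b ∘ₗ a := by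
  classical
  obtain ⟨n, e, he⟩ := Module.Finite.exists_fin' A M
  obtain ⟨s, hs⟩ := Module.projective_def'.1 ‹Module.Projective A Q›
  let S : Finset Q := Finset.univ.biUnion fun j : Fin n => (s (a (e (Pi.single j 1)))).support
  have hS : ∀ x, s (a x) ∈ Finsupp.supported A A (S : Set Q) := by
    intro x
    obtain ⟨y, rfl⟩ := he x
    rw [← LinearMap.sum_single_apply (fun _ : Fin n => A) y, map_sum, map_sum, map_sum]
    refine Submodule.sum_mem _ fun j _ => ?_
    have : Pi.single j (y j) = y j • Pi.single (M := fun _ : Fin n => A) j (1 : A) := by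
      rw [← Pi.single_smul, smul_eq_mul, mul_one]
    rw [this, map_smul, map_smul, map_smul]
    refine Submodule.smul_mem _ _ ?_
    rw [Finsupp.mem_supported]
    exact_mod_cast Finset.subset_biUnion_of_mem
      (fun j : Fin n => (s (a (e (Pi.single j 1)))).support) (Finset.mem_univ j)
  let t : M →ₗ[A] (S →₀ A) := (Finsupp.supportedEquivFinsupp (S : Set Q)).toLinearMap ∘ₗ
    (s ∘ₗ a).codRestrict _ hS
  let ε : (S →₀ A) ≃ₗ[A] (Fin (Fintype.card S) → A) :=
    (Finsupp.linearEquivFunOnFinite A A S).trans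
      (LinearEquiv.funCongrLeft A A (Fintype.equivFin S).symm)
  refine ⟨Fintype.card S, ε.toLinearMap ∘ₗ t, b ∘ₗ Finsupp.linearCombination A id ∘ₗ
    (Finsupp.supported A A (S : Set Q)).subtype ∘ₗ
    (Finsupp.supportedEquivFinsupp (S : Set Q)).symm.toLinearMap ∘ₗ ε.symm.toLinearMap, ?_⟩
  ext x
  have := LinearMap.congr_fun hs (a x)
  simp only [LinearMap.comp_apply, LinearMap.id_apply] at this
  simp [t, this]

theorem mem_projIdeal_iff_extends (hid : InjDimLE1 A) (hM : InSub A M) {K : Type} [AddCommGroup K]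
    [Module A K] [Module.Finite A K] [Module.Finite A P] [Module.Projective A P]
    {i : K →ₗ[A] P} {p : P →ₗ[A] M} (hi : Function.Injective i)
    (hip : LinearMap.range i = LinearMap.ker p) (f : Module.End A K) :
    f ∈ projIdeal A K ↔ ∃ g : P →ₗ[A] K, g ∘ₗ i = f := by
  refine ⟨fun hf => ?_, ?_⟩
  · let I : TwoSidedIdeal (Module.End A K) := TwoSidedIdeal.mk' {f | ∃ g : P →ₗ[A] K, g ∘ₗ i = f}
      ⟨0, LinearMap.zero_comp _⟩
      (by
        rintro _ _ ⟨b, rfl⟩ ⟨c, rfl⟩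
        exact ⟨b + c, LinearMap.add_comp ..⟩)
      (by
        rintro _ ⟨b, rfl⟩
        exact ⟨-b, LinearMap.neg_comp ..⟩)
      (by
        rintro x _ ⟨b, rfl⟩
        exact ⟨x ∘ₗ b, rfl⟩)
      (by
        rintro _ x ⟨b, rfl⟩
        obtain ⟨y, hy⟩ := hM.exists_extension hid i p hi hip (i ∘ₗ x)
        exact ⟨b ∘ₗ y, by rw [LinearMap.comp_assoc, hy]; rfl⟩)
    have hI : projIdeal A K ≤ I := TwoSidedIdeal.span_le.2 (by
      rintro _ ⟨Q, hQ, a, b, rfl⟩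
      obtain ⟨n, a', b', hab⟩ := exists_factorization_fin a b
      obtain ⟨c, rfl⟩ := hM.exists_extension hid i p hi hip a'
      exact (TwoSidedIdeal.mem_mk' ..).2 ⟨b' ∘ₗ c, hab⟩)
    simpa only [I, TwoSidedIdeal.mem_mk', Set.mem_ofPred_eq] using hI hf
  · rintro ⟨g, rfl⟩
    exact mem_projIdeal_of_factors i g

/-- The projection from the endomorphism ring onto the stable endomorphism ring. -/
noncomputable def StableEnd.mk (A : Type) [Ring A] (M : Type) [AddCommGroup M] [Module A M] :
    Module.End A M →+* StableEnd A M :=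
  (projIdeal A M).ringCon.mk'

theorem StableEnd.mk_surjective : Function.Surjective (StableEnd.mk A M) :=
  (projIdeal A M).ringCon.mk'_surjective

theorem StableEnd.mk_eq_zero_iff (f : Module.End A M) :
    StableEnd.mk A M f = 0 ↔ f ∈ projIdeal A M :=
  ((projIdeal A M).ringCon.eq (a := f) (b := 0)).trans (TwoSidedIdeal.mem_iff ..).symm

theorem RingHom.nonempty_ringEquiv_of_ker_eq {R S T : Type} [Ring R] [Ring S] [Ring T]
    {f : R →+* S} {g : R →+* T} (hf : Function.Surjective f) (hg : Function.Surjective g)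
    (h : ∀ x, f x = 0 ↔ g x = 0) : Nonempty (S ≃+* T) := by
  have hk : RingHom.ker f = RingHom.ker g := Ideal.ext h
  exact ⟨(RingHom.quotientKerEquivOfSurjective hf).symm.trans
    ((Ideal.quotEquivOfEq hk).trans (RingHom.quotientKerEquivOfSurjective hg))⟩

theorem nonempty_stableEnd_equiv_syzygy (hid : InjDimLE1 A) (hM : InSub A M)
    [Module.Finite A P] [Module.Projective A P] {p : P →ₗ[A] M} (hp : Function.Surjective p)
    [Module.Finite A (LinearMap.ker p)] :
    Nonempty (StableEnd A M ≃+* StableEnd A (LinearMap.ker p)) := by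
  let K := LinearMap.ker p
  let i : K →ₗ[A] P := K.subtype
  have hi : Function.Injective i := Subtype.val_injective
  have hip : LinearMap.range i = LinearMap.ker p := Submodule.range_subtype _
  let B : Subring (Module.End A P) :=
    { carrier := {u | ∀ x ∈ K, u x ∈ K}
      mul_mem' := fun hu hv x hx => hu _ (hv x hx)
      one_mem' := fun x hx => hx
      add_mem' := fun hu hv x hx => K.add_mem (hu x hx) (hv x hx)
      zero_mem' := fun x _ => K.zero_mem
      neg_mem' := fun hu x hx => K.neg_mem (hu x hx) }
  have hB : ∀ u : B, ∃ v : Module.End A M, v ∘ₗ p = p ∘ₗ u.1 := fun u =>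
    exists_comp_eq_of_ker_le hp fun x hx => u.2 x hx
  choose F hF using hB
  have hF' : ∀ u x, F u (p x) = p (u.1 x) := fun u x => LinearMap.congr_fun (hF u) x
  have hFu : ∀ (u : B) (v : Module.End A M), v ∘ₗ p = p ∘ₗ u.1 → F u = v := by
    intro u v h
    ext m
    obtain ⟨x, rfl⟩ := hp m
    rw [hF']
    exact (LinearMap.congr_fun h x).symm
  let f : B →+* Module.End A M :=
    { toFun := F
      map_one' := hFu _ _ rfl
      map_mul' := fun u v => hFu _ _ (by ext x; simp [hF'])
      map_zero' := hFu _ _ (by ext x; simp)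
      map_add' := fun u v => hFu _ _ (by ext x; simp [hF']) }
  let g : B →+* Module.End A K :=
    { toFun := fun u => u.1.restrict u.2
      map_one' := rfl
      map_mul' := fun _ _ => rfl
      map_zero' := rfl
      map_add' := fun _ _ => rfl }
  refine RingHom.nonempty_ringEquiv_of_ker_eq (f := (StableEnd.mk A M).comp f)
    (g := (StableEnd.mk A K).comp g) (StableEnd.mk_surjective.comp ?_)
    (StableEnd.mk_surjective.comp ?_) fun u => ?_
  · intro v
    obtain ⟨u, hu⟩ := Module.projective_lifting_property p (v ∘ₗ p) hp
    have hu' : ∀ x, p (u x) = v (p x) := LinearMap.congr_fun hu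
    refine ⟨⟨u, fun x hx => ?_⟩, hFu _ _ hu.symm⟩
    rw [LinearMap.mem_ker, hu', LinearMap.mem_ker.1 hx, map_zero]
  · intro w
    obtain ⟨u, hu⟩ := hM.exists_extension hid i p hi hip (i ∘ₗ w)
    have hu' : ∀ x : K, u x = w x := LinearMap.congr_fun hu
    refine ⟨⟨u, fun x hx => ?_⟩, ?_⟩
    · rw [hu' ⟨x, hx⟩]
      exact (w ⟨x, hx⟩).2
    · ext x
      exact hu' x
  · change StableEnd.mk A M (F u) = 0 ↔ StableEnd.mk A K (u.1.restrict u.2) = 0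
    rw [StableEnd.mk_eq_zero_iff, StableEnd.mk_eq_zero_iff, mem_projIdeal_iff_factors_cover hp,
      mem_projIdeal_iff_extends hid hM hi hip]
    constructor
    · rintro ⟨b, hb⟩
      have hb' : ∀ x, p (b (p x)) = p (u.1 x) := fun x =>
        (LinearMap.congr_fun hb (p x)).trans (hF' u x)
      obtain ⟨c, hc⟩ := exists_comp_eq_of_range_le hi (h := u.1 - b ∘ₗ p) (by
        rw [hip]
        rintro _ ⟨x, rfl⟩
        simp [hb'])
      refine ⟨c, ?_⟩
      ext x
      have := LinearMap.congr_fun hc x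
      simpa [i] using this
    · rintro ⟨c, hc⟩
      have hc' : ∀ x : K, (c x : P) = u.1 x := fun x =>
        congrArg Subtype.val (LinearMap.congr_fun hc x)
      obtain ⟨b, hb⟩ := exists_comp_eq_of_ker_le hp (h := u.1 - i ∘ₗ c) (by
        intro x hx
        have := hc' ⟨x, hx⟩
        simp [i, this])
      refine ⟨b, (hFu _ _ ?_).symm⟩
      ext x
      have h1 := LinearMap.congr_fun hb x
      have h2 : p (c x : P) = 0 := (c x).2
      simp only [LinearMap.comp_apply] at h1
      simp [h1, i, h2]

end StableEnd

section AdditiveFunction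

/-- The rational-valued functions on finitely generated modules that are additive on short exact
sequences, i.e. the rational dual of the Grothendieck group. -/
def AdditiveFunction (R : Type) [Ring R] : Submodule ℚ (FGModuleCat.{0} R → ℚ) where
  carrier := {φ | ∀ (X Y Z : Type) [AddCommGroup X] [AddCommGroup Y] [AddCommGroup Z]
    [Module R X] [Module R Y] [Module R Z] [Module.Finite R X] [Module.Finite R Y]
    [Module.Finite R Z] (f : X →ₗ[R] Y) (g : Y →ₗ[R] Z), Function.Injective f →
    Function.Surjective g → LinearMap.range f = LinearMap.ker g →
    φ (.of R Y) = φ (.of R X) + φ (.of R Z)}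
  zero_mem' := fun _ _ _ _ _ _ _ _ _ _ _ _ _ _ _ _ _ => by simp
  add_mem' := fun {φ ψ} hφ hψ X Y Z _ _ _ _ _ _ _ _ _ f g hf hg hfg => by
    simp only [Pi.add_apply, hφ X Y Z f g hf hg hfg, hψ X Y Z f g hf hg hfg]
    ring
  smul_mem' := fun c φ hφ X Y Z _ _ _ _ _ _ _ _ _ f g hf hg hfg => by
    simp only [Pi.smul_apply, hφ X Y Z f g hf hg hfg, smul_add]

variable {R : Type} [Ring R]

namespace AdditiveFunction

variable {X Y Z : Type} [AddCommGroup X] [AddCommGroup Y] [AddCommGroup Z]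
  [Module R X] [Module R Y] [Module R Z] [Module.Finite R X] [Module.Finite R Y]
  [Module.Finite R Z] {φ : FGModuleCat.{0} R → ℚ}

theorem map_exact (hφ : φ ∈ AdditiveFunction R) (f : X →ₗ[R] Y) (g : Y →ₗ[R] Z)
    (hf : Function.Injective f) (hg : Function.Surjective g)
    (hfg : LinearMap.range f = LinearMap.ker g) :
    φ (.of R Y) = φ (.of R X) + φ (.of R Z) :=
  hφ X Y Z f g hf hg hfg

theorem map_of_subsingleton [Subsingleton X] (hφ : φ ∈ AdditiveFunction R) :
    φ (.of R X) = 0 := by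
  have := map_exact hφ (LinearMap.id : X →ₗ[R] X) (LinearMap.id : X →ₗ[R] X)
    Function.injective_id Function.surjective_id (Subsingleton.elim _ _)
  linarith

theorem map_linearEquiv (hφ : φ ∈ AdditiveFunction R) (e : X ≃ₗ[R] Y) :
    φ (.of R X) = φ (.of R Y) := by
  have := map_exact hφ e.toLinearMap (0 : Y →ₗ[R] (Fin 0 → R)) e.injective
    (Function.surjective_to_subsingleton _) (by simp)
  rw [this, map_of_subsingleton (X := Fin 0 → R) hφ, add_zero]

theorem map_quotient_of_isCoatom (hφ : φ ∈ AdditiveFunction R) [IsNoetherianRing R]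
    (s : CompositionSeries (Submodule R R)) (h0 : s.head = ⊥) (h1 : s.last = ⊤)
    (hs : ∀ i, φ (.of R (s i)) = 0) (m : Submodule R R) (hm : IsCoatom m) :
    φ (.of R (R ⧸ m)) = 0 := by
  obtain ⟨i, hi, hi'⟩ : ∃ i : Fin s.length, s i.castSucc ≤ m ∧ ¬ s i.succ ≤ m := by
    by_contra! hcon
    have hle : ∀ i, s i ≤ m := fun i => by
      induction i using Fin.induction with
      | zero => exact (show s 0 = ⊥ from h0) ▸ bot_le
      | succ i ih => exact hcon i ih
    exact hm.1 (top_le_iff.1 ((show s (Fin.last _) = ⊤ from h1) ▸ hle (Fin.last _)))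
  have hcov : s i.castSucc ⋖ s i.succ := s.step i
  have hinf : s i.succ ⊓ m = s i.castSucc := by
    refine ((hcov.eq_or_eq (le_inf hcov.le hi) inf_le_left).resolve_right fun h => hi' ?_)
    exact inf_eq_left.1 h
  have hsup : s i.succ ⊔ m = ⊤ :=
    hm.2 _ (lt_of_le_of_ne le_sup_right fun h => hi' (h ▸ le_sup_left))
  have := map_exact hφ (Submodule.inclusion hcov.le) (m.mkQ ∘ₗ (s i.succ).subtype)
    (Submodule.inclusion_injective _) (by
      rw [← LinearMap.range_eq_top, LinearMap.range_comp, Submodule.range_subtype]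
      apply Submodule.comap_injective_of_surjective m.mkQ_surjective
      rw [Submodule.comap_map_mkQ, sup_comm, hsup, Submodule.comap_top])
    (by
      rw [Submodule.range_inclusion, LinearMap.ker_comp, Submodule.ker_mkQ, ← hinf]
      ext x
      simp)
  rw [hs, hs] at this
  linarith

theorem eq_zero_of_isCoatom (hφ : φ ∈ AdditiveFunction R) [IsNoetherianRing R] [IsArtinianRing R]
    (h : ∀ m : Submodule R R, IsCoatom m → φ (.of R (R ⧸ m)) = 0) : φ = 0 := by
  funext U
  have key : ∀ N : Submodule R U, φ (.of R N) = 0 := by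
    intro N
    induction N using WellFoundedLT.induction with
    | _ N ih =>
      rcases subsingleton_or_nontrivial N with hN | hN
      · exact map_of_subsingleton hφ
      obtain ⟨L, hL, -⟩ := (eq_top_or_exists_le_coatom (⊥ : Submodule R N)).resolve_left
        bot_ne_top
      have hsimple : IsSimpleModule R (N ⧸ L) := isSimpleModule_iff_isCoatom.2 hL
      obtain ⟨m, hm, ⟨e⟩⟩ := isSimpleModule_iff_quot_maximal.1 hsimple
      have hlt : L.map N.subtype < N := by
        have := Submodule.map_strictMono_of_injective N.injective_subtype (lt_top_iff_ne_top.2 hL.1)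
        rwa [Submodule.map_top, Submodule.range_subtype] at this
      have hL0 := ih _ hlt
      rw [← map_linearEquiv hφ (Submodule.equivMapOfInjective N.subtype N.injective_subtype L)]
        at hL0
      rw [map_exact hφ L.subtype L.mkQ L.injective_subtype L.mkQ_surjective (by simp), hL0,
        map_linearEquiv hφ e, h m hm.out, add_zero]
  rw [show φ U = φ (.of R U) from rfl,
    map_linearEquiv hφ (Submodule.topEquiv (R := R) (M := U)).symm]
  exact key ⊤

instance [IsNoetherianRing R] [IsArtinianRing R] : FiniteDimensional ℚ (AdditiveFunction R) := by
  obtain ⟨s, h0, h1⟩ := exists_compositionSeries_of_isNoetherian_isArtinian R R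
  let ev : AdditiveFunction R →ₗ[ℚ] (Fin (s.length + 1) → ℚ) :=
    LinearMap.pi fun i => LinearMap.proj (FGModuleCat.of R (s i)) ∘ₗ (AdditiveFunction R).subtype
  refine FiniteDimensional.of_injective ev ((injective_iff_map_eq_zero ev).2 fun φ hφ => ?_)
  exact Subtype.ext (eq_zero_of_isCoatom φ.2 fun m hm =>
    map_quotient_of_isCoatom φ.2 s h0 h1 (fun i => congrFun hφ i) m hm)

theorem length_mem [IsNoetherianRing R] [IsArtinianRing R] :
    (fun U : FGModuleCat.{0} R => ((Module.length R U).toNat : ℚ)) ∈ AdditiveFunction R := by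
  intro X Y Z _ _ _ _ _ _ _ _ _ f g hf hg hfg
  have h := Module.length_eq_add_of_exact f g hf hg (LinearMap.exact_iff.2 hfg.symm)
  change ((Module.length R Y).toNat : ℚ) = (Module.length R X).toNat + (Module.length R Z).toNat
  rw [h, ENat.toNat_add Module.length_ne_top Module.length_ne_top, Nat.cast_add]

end AdditiveFunction

end AdditiveFunction

section TwistedDual

variable {k : Type} [Field k] {B C : Type} [Ring B] [Ring C] [Algebra k B] [Algebra k C]

/-- A `B`-module, regarded as a module over the ground field `k`. -/
def GroundModule (k B V : Type) [Field k] [Ring B] [Algebra k B] [AddCommGroup V] [Module B V] :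
    Type := V

namespace GroundModule

variable (V : Type) [AddCommGroup V] [Module B V]

instance : AddCommGroup (GroundModule k B V) := inferInstanceAs (AddCommGroup V)

instance : Module B (GroundModule k B V) := inferInstanceAs (Module B V)

instance : Module k (GroundModule k B V) := Module.compHom V (algebraMap k B)

instance : IsScalarTower k B (GroundModule k B V) := .of_algebraMap_smul fun _ _ => rfl

instance [FiniteDimensional k B] [Module.Finite B V] :
    FiniteDimensional k (GroundModule k B V) := by
  have : Module.Finite B (GroundModule k B V) := inferInstanceAs (Module.Finite B V)
  exact Module.Finite.trans B _

end GroundModule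

/-- The `k`-linear dual of a `B`-module, as a module over `C` along `e : C → Bᵐᵒᵖ`. -/
def TwistedDual (_e : C →ₐ[k] Bᵐᵒᵖ) (V : Type) [AddCommGroup V] [Module B V] : Type :=
  Module.Dual k (GroundModule k B V)

namespace TwistedDual

variable (e : C →ₐ[k] Bᵐᵒᵖ) (V : Type) [AddCommGroup V] [Module B V]

noncomputable instance : AddCommGroup (TwistedDual e V) :=
  inferInstanceAs (AddCommGroup (Module.Dual k (GroundModule k B V)))

noncomputable instance : Module k (TwistedDual e V) :=
  inferInstanceAs (Module k (Module.Dual k (GroundModule k B V)))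

noncomputable instance : Module C (TwistedDual e V) where
  smul c ξ := LinearMap.comp (M₂ := GroundModule k B V) ξ
    (Algebra.lsmul k k (GroundModule k B V) (e c).unop)
  one_smul ξ := LinearMap.ext fun v => congrArg ξ.toFun (by simp)
  mul_smul c d ξ := LinearMap.ext fun v => congrArg ξ.toFun (by simp)
  smul_zero _ := rfl
  smul_add _ _ _ := rfl
  add_smul c d ξ := LinearMap.ext fun v => by
    refine (congrArg ξ.toFun ?_).trans (ξ.map_add' _ _)
    simp
  zero_smul ξ := LinearMap.ext fun v => by
    refine (congrArg ξ.toFun ?_).trans ξ.map_zero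
    simp

/-- Elements of the twisted dual as functions. -/
def eval (ξ : TwistedDual e V) (v : V) : k := ξ.toFun v

variable {e V}

@[simp] theorem eval_smul (c : C) (ξ : TwistedDual e V) (v : V) :
    eval e V (c • ξ) v = eval e V ξ ((e c).unop • v) := rfl

theorem eval_map_add (ξ : TwistedDual e V) (v w : V) :
    eval e V ξ (v + w) = eval e V ξ v + eval e V ξ w := ξ.map_add' v w

theorem eval_map_smul (ξ : TwistedDual e V) (c : k) (v : V) :
    eval e V ξ (algebraMap k B c • v) = c * eval e V ξ v := ξ.map_smul' c v

@[ext] theorem ext {ξ η : TwistedDual e V} (h : ∀ v, eval e V ξ v = eval e V η v) : ξ = η :=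
  LinearMap.ext h

variable (e V) in
/-- Constructor for elements of the twisted dual. -/
def mk (f : V → k) (hadd : ∀ v w, f (v + w) = f v + f w)
    (hsmul : ∀ (c : k) v, f (algebraMap k B c • v) = c * f v) : TwistedDual e V :=
  { toFun := f, map_add' := hadd, map_smul' := hsmul : Module.Dual k (GroundModule k B V) }

@[simp] theorem algebraMap_smul (c : k) (ξ : TwistedDual e V) : algebraMap k C c • ξ = c • ξ := by
  ext v
  rw [eval_smul, e.commutes, MulOpposite.algebraMap_apply, MulOpposite.unop_op, eval_map_smul]
  rfl

instance [FiniteDimensional k B] [Module.Finite B V] : Module.Finite C (TwistedDual e V) := by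
  have : FiniteDimensional k (TwistedDual e V) :=
    inferInstanceAs (FiniteDimensional k (Module.Dual k (GroundModule k B V)))
  have : IsScalarTower k C (TwistedDual e V) := .of_algebraMap_smul algebraMap_smul
  exact Module.Finite.of_restrictScalars_finite k C _

variable {W Z : Type} [AddCommGroup W] [Module B W] [AddCommGroup Z] [Module B Z]

/-- A linear map, with scalars restricted to the ground field. -/
def restrictMap (k : Type) [Field k] [Algebra k B] (f : V →ₗ[B] W) :
    GroundModule k B V →ₗ[k] GroundModule k B W where
  toFun := f
  map_add' := f.map_add
  map_smul' c := f.map_smul (algebraMap k B c)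

variable (e) in
/-- The transpose of a linear map. -/
noncomputable def map (f : V →ₗ[B] W) : TwistedDual e W →ₗ[C] TwistedDual e V where
  toFun := (restrictMap k f).dualMap
  map_add' := map_add _
  map_smul' _ ξ := LinearMap.ext fun v => congrArg ξ.toFun (f.map_smul _ v).symm

theorem map_injective {f : V →ₗ[B] W} (hf : Function.Surjective f) :
    Function.Injective (map e f) :=
  LinearMap.dualMap_injective_of_surjective (f := restrictMap k f) hf

theorem map_surjective {f : V →ₗ[B] W} (hf : Function.Injective f) :
    Function.Surjective (map e f) :=
  LinearMap.dualMap_surjective_of_injective (f := restrictMap k f) hf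

theorem range_map {f : V →ₗ[B] W} {g : W →ₗ[B] Z}
    (hfg : LinearMap.range f = LinearMap.ker g) :
    LinearMap.range (map e g) = LinearMap.ker (map e f) := by
  have hg' :
      LinearMap.range (restrictMap k g).dualMap = LinearMap.ker (restrictMap k f).dualMap := by
    rw [LinearMap.range_dualMap_eq_dualAnnihilator_ker,
      LinearMap.ker_dualMap_eq_dualAnnihilator_range]
    congr 1
    ext v
    exact (SetLike.ext_iff.1 hfg v).symm
  ext ξ
  exact SetLike.ext_iff.1 hg' ξ

/-- Every module is the twisted dual of a twisted dual. -/
theorem exists_linearEquiv (e : C ≃ₐ[k] Bᵐᵒᵖ) (U : Type) [AddCommGroup U] [Module C U]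
    [FiniteDimensional k C] [Module.Finite C U] (e' : B →ₐ[k] Cᵐᵒᵖ)
    (he : ∀ b, (e' b).unop = e.symm (.op b)) :
    Nonempty (U ≃ₗ[C] TwistedDual (e : C →ₐ[k] Bᵐᵒᵖ) (TwistedDual e' U)) := by
  let F : U →ₗ[C] TwistedDual (e : C →ₐ[k] Bᵐᵒᵖ) (TwistedDual e' U) :=
    { toFun := fun u => mk _ _ (fun ξ => eval e' U ξ u) (fun _ _ => rfl) fun c ξ => by
        rw [algebraMap_smul]
        rfl
      map_add' := fun u v => by
        ext ξ
        exact eval_map_add ξ u v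
      map_smul' := fun c u => by
        ext ξ
        refine congrArg (eval e' U ξ) ?_
        change c • u = (e' (e c).unop).unop • u
        rw [he, MulOpposite.op_unop, e.symm_apply_apply] }
  refine ⟨LinearEquiv.ofBijective F ⟨fun u v huv => ?_, fun η => ?_⟩⟩
  · refine Module.eval_apply_injective k (V := GroundModule k C U) (LinearMap.ext fun ξ => ?_)
    exact congrArg (fun η => eval (e : C →ₐ[k] Bᵐᵒᵖ) (TwistedDual e' U) η ξ) huv
  · obtain ⟨u, hu⟩ := (Module.evalEquiv k (GroundModule k C U)).surjective
      { toFun := eval (e : C →ₐ[k] Bᵐᵒᵖ) (TwistedDual e' U) η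
        map_add' := eval_map_add η
        map_smul' := fun c ξ => by
          exact (congrArg _ (algebraMap_smul (e := e') c ξ).symm).trans (eval_map_smul η c _) }
    exact ⟨u, ext fun ξ => LinearMap.congr_fun hu ξ⟩

end TwistedDual

/-- Precomposition with the twisted dual. -/
noncomputable def AdditiveFunction.precompDual (e : C →ₐ[k] Bᵐᵒᵖ) [FiniteDimensional k B] :
    AdditiveFunction C →ₗ[ℚ] AdditiveFunction B where
  toFun φ := ⟨fun V => φ.1 (.of C (TwistedDual e V)),
    fun X Y Z _ _ _ _ _ _ _ _ _ f g hf hg hfg => by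
    rw [add_comm]
    exact AdditiveFunction.map_exact φ.2 (TwistedDual.map e g) (TwistedDual.map e f)
      (TwistedDual.map_injective hg) (TwistedDual.map_surjective hf) (TwistedDual.range_map hfg)⟩
  map_add' _ _ := rfl
  map_smul' _ _ := rfl

theorem AdditiveFunction.precompDual_injective (e : C ≃ₐ[k] Bᵐᵒᵖ) (e' : B →ₐ[k] Cᵐᵒᵖ)
    (he : ∀ b, (e' b).unop = e.symm (.op b)) [FiniteDimensional k B] [FiniteDimensional k C] :
    Function.Injective (precompDual (e : C →ₐ[k] Bᵐᵒᵖ)) := by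
  refine (injective_iff_map_eq_zero _).2 fun φ hφ => Subtype.ext (funext fun U => ?_)
  obtain ⟨f⟩ := TwistedDual.exists_linearEquiv e U e' he
  exact (AdditiveFunction.map_linearEquiv φ.2 f).trans
    (congrFun (congrArg Subtype.val hφ) (.of B (TwistedDual e' U)))

end TwistedDual

section Extension

variable {A : Type} [Ring A]

/-- Additivity on short exact sequences of submodules of free modules. -/
def IsSubAdditive (θ : FGModuleCat.{0} A → ℚ) : Prop :=
  ∀ (X Y Z : Type) [AddCommGroup X] [AddCommGroup Y] [AddCommGroup Z]
    [Module A X] [Module A Y] [Module A Z] [Module.Finite A X] [Module.Finite A Y]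
    [Module.Finite A Z] (f : X →ₗ[A] Y) (g : Y →ₗ[A] Z), InSub A Y → InSub A Z →
    Function.Injective f → Function.Surjective g → LinearMap.range f = LinearMap.ker g →
    θ (.of A Y) = θ (.of A X) + θ (.of A Z)

/-- The value on `U` of the additive extension of `θ`, computed from a free presentation. -/
noncomputable def additiveExtension [IsNoetherianRing A] (θ : FGModuleCat.{0} A → ℚ)
    (U : FGModuleCat.{0} A) : ℚ :=
  θ (.of A (Fin (Module.Finite.exists_fin' A U).choose → A)) -
    θ (.of A (LinearMap.ker (Module.Finite.exists_fin' A U).choose_spec.choose))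

namespace IsSubAdditive

variable [IsNoetherianRing A] {θ : FGModuleCat.{0} A → ℚ}
  {X Y Z K P W : Type} [AddCommGroup X] [AddCommGroup Y] [AddCommGroup Z] [AddCommGroup K]
  [AddCommGroup P] [AddCommGroup W] [Module A X] [Module A Y] [Module A Z] [Module A K]
  [Module A P] [Module A W] [Module.Finite A X] [Module.Finite A Y]
  [Module.Finite A Z] [Module.Finite A K] [Module.Finite A P]

theorem sub_eq_sub (hθ : IsSubAdditive θ) (hY : InSub A Y) (hP : InSub A P)
    {f : X →ₗ[A] Y} {g : Y →ₗ[A] W} (hf : Function.Injective f) (hg : Function.Surjective g)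
    (hfg : LinearMap.range f = LinearMap.ker g) {i : K →ₗ[A] P} {q : P →ₗ[A] W}
    (hi : Function.Injective i) (hq : Function.Surjective q)
    (hiq : LinearMap.range i = LinearMap.ker q) :
    θ (.of A Y) - θ (.of A X) = θ (.of A P) - θ (.of A K) := by
  let E := LinearMap.ker (g.coprod (-q))
  have mem_E : ∀ z : Y × P, z ∈ E ↔ g z.1 = q z.2 := fun z => by
    simp [E, ← sub_eq_add_neg, sub_eq_zero]
  have hE : InSub A E := (hY.prod hP).of_injective E.subtype E.injective_subtype
  have hgf : ∀ x, g (f x) = 0 := fun x => by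
    have : f x ∈ LinearMap.ker g := hfg ▸ ⟨x, rfl⟩
    exact this
  have hqi : ∀ x, q (i x) = 0 := fun x => by
    have : i x ∈ LinearMap.ker q := hiq ▸ ⟨x, rfl⟩
    exact this
  let a : X →ₗ[A] E := (LinearMap.inl A Y P ∘ₗ f).codRestrict E fun x => by simp [mem_E, hgf]
  let b : K →ₗ[A] E := (LinearMap.inr A Y P ∘ₗ i).codRestrict E fun x => by simp [mem_E, hqi]
  have h1 := hθ X E P a (LinearMap.snd A Y P ∘ₗ E.subtype) hE hP
    (fun x y h => hf (congrArg (fun z : E => z.1.1) h))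
    (fun p => by
      obtain ⟨y, hy⟩ := hg (q p)
      exact ⟨⟨(y, p), (mem_E _).2 hy⟩, rfl⟩)
    (by
      ext ⟨⟨y, p⟩, hz⟩
      have hz' := (mem_E _).1 hz
      constructor
      · rintro ⟨x, hx⟩
        exact (congrArg (fun z : E => z.1.2) hx).symm
      · intro (hp : p = 0)
        have : y ∈ LinearMap.range f := by
          rw [hfg, LinearMap.mem_ker]
          simpa [hp] using hz'
        obtain ⟨x, hx⟩ := this
        exact ⟨x, Subtype.ext (Prod.ext hx hp.symm)⟩)
  have h2 := hθ K E Y b (LinearMap.fst A Y P ∘ₗ E.subtype) hE hY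
    (fun x y h => hi (congrArg (fun z : E => z.1.2) h))
    (fun y => by
      obtain ⟨p, hp⟩ := hq (g y)
      exact ⟨⟨(y, p), (mem_E _).2 hp.symm⟩, rfl⟩)
    (by
      ext ⟨⟨y, p⟩, hz⟩
      have hz' := (mem_E _).1 hz
      constructor
      · rintro ⟨x, hx⟩
        exact (congrArg (fun z : E => z.1.1) hx).symm
      · intro (hp : y = 0)
        have : p ∈ LinearMap.range i := by
          rw [hiq, LinearMap.mem_ker]
          simpa [hp] using hz'.symm
        obtain ⟨x, hx⟩ := this
        exact ⟨x, Subtype.ext (Prod.ext hp.symm hx)⟩)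
  linarith

theorem additiveExtension_eq_sub [Module.Finite A W] (hθ : IsSubAdditive θ) (hP : InSub A P)
    {i : K →ₗ[A] P} {q : P →ₗ[A] W}
    (hi : Function.Injective i) (hq : Function.Surjective q)
    (hiq : LinearMap.range i = LinearMap.ker q) :
    additiveExtension θ (.of A W) = θ (.of A P) - θ (.of A K) :=
  hθ.sub_eq_sub (inSub_of_projective _) hP
    (f := (LinearMap.ker (Module.Finite.exists_fin' A W).choose_spec.choose).subtype)
    (Submodule.injective_subtype _) (Module.Finite.exists_fin' A W).choose_spec.choose_spec
    (Submodule.range_subtype _) hi hq hiq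

theorem additiveExtension_eq_self (hθ : IsSubAdditive θ) (hX : InSub A X) :
    additiveExtension θ (.of A X) = θ (.of A X) := by
  have h0 := hθ (Fin 0 → A) (Fin 0 → A) (Fin 0 → A) LinearMap.id LinearMap.id
    (inSub_of_projective _) (inSub_of_projective _) Function.injective_id Function.surjective_id
    (Subsingleton.elim _ _)
  rw [hθ.additiveExtension_eq_sub hX (i := (0 : (Fin 0 → A) →ₗ[A] X)) (q := LinearMap.id)
    (Function.injective_of_subsingleton _) Function.surjective_id (by simp)]
  linarith

theorem additiveExtension_mem (hθ : IsSubAdditive θ) :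
    additiveExtension θ ∈ AdditiveFunction A := by
  intro X Y Z _ _ _ _ _ _ _ _ _ f g hf hg hfg
  obtain ⟨n, π, hπ⟩ := Module.Finite.exists_fin' A Y
  obtain ⟨q, hq⟩ := exists_comp_eq_of_range_le hf
    (h := π ∘ₗ (LinearMap.ker (g ∘ₗ π)).subtype) (by
      rintro _ ⟨x, rfl⟩
      rw [hfg]
      exact x.2)
  have hq' : ∀ x, f (q x) = π x.1 := fun x => LinearMap.congr_fun hq x
  have hfree : InSub A (Fin n → A) := inSub_of_projective _
  rw [hθ.additiveExtension_eq_sub hfree (LinearMap.ker π).injective_subtype hπ (by simp),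
    hθ.additiveExtension_eq_sub (q := g ∘ₗ π) hfree (LinearMap.ker (g ∘ₗ π)).injective_subtype
      (hg.comp hπ) (by simp),
    hθ.additiveExtension_eq_sub (W := X) (q := q)
      (hfree.of_injective _ (LinearMap.ker (g ∘ₗ π)).injective_subtype)
      (i := Submodule.inclusion (LinearMap.ker_le_ker_comp π g))
      (Submodule.inclusion_injective _) ?_ ?_]
  · ring
  · intro x
    obtain ⟨y, hy⟩ := hπ (f x)
    have hx : f x ∈ LinearMap.ker g := hfg ▸ ⟨x, rfl⟩
    refine ⟨⟨y, ?_⟩, hf ?_⟩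
    · rw [LinearMap.mem_ker, LinearMap.comp_apply, hy]
      exact hx
    · rw [hq', hy]
  · ext x
    rw [Submodule.range_inclusion, Submodule.mem_comap, LinearMap.mem_ker, LinearMap.mem_ker,
      ← hf.eq_iff, hq', map_zero]
    rfl

end IsSubAdditive

end Extension

section RingDual

variable {A : Type} [Ring A] {X Y Z : Type} [AddCommGroup X] [AddCommGroup Y] [AddCommGroup Z]
  [Module A X] [Module A Y] [Module A Z]

/-- The dual of a free module of finite rank is free on the coordinate functions. -/
noncomputable def ringDualPi (A : Type) [Ring A] (n : ℕ) :
    (Fin n → Aᵐᵒᵖ) ≃ₗ[Aᵐᵒᵖ] ((Fin n → A) →ₗ[A] A) :=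
  .ofBijective (Fintype.linearCombination Aᵐᵒᵖ fun i : Fin n => LinearMap.proj (φ := fun _ => A) i)
    ⟨fun a b h => funext fun i => by
      have := LinearMap.congr_fun h (Pi.single i 1)
      simpa [Fintype.linearCombination_apply, Pi.single_apply] using this,
    fun h => ⟨fun i => .op (h (Pi.single i 1)), by
      ext i
      simp [Fintype.linearCombination_apply, Pi.single_apply]⟩⟩

theorem ringDualPi_apply (n : ℕ) (a : Fin n → Aᵐᵒᵖ) (x : Fin n → A) :
    ringDualPi A n a x = ∑ i, x i * (a i).unop := by
  change (Fintype.linearCombination Aᵐᵒᵖ (fun i : Fin n => LinearMap.proj (φ := fun _ => A) i) a) x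
    = _
  simp [Fintype.linearCombination_apply]

theorem lcomp_injective {f : X →ₗ[A] Y} (hf : Function.Surjective f) :
    Function.Injective (LinearMap.lcomp Aᵐᵒᵖ A f) :=
  fun _ _ h => (LinearMap.cancel_right hf).1 h

instance [IsNoetherianRing Aᵐᵒᵖ] [Module.Finite A X] : Module.Finite Aᵐᵒᵖ (X →ₗ[A] A) := by
  obtain ⟨n, π, hπ⟩ := Module.Finite.exists_fin' A X
  exact Module.Finite.of_injective ((ringDualPi A n).symm.toLinearMap ∘ₗ LinearMap.lcomp Aᵐᵒᵖ A π)
    ((ringDualPi A n).symm.injective.comp (lcomp_injective hπ))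

/-- A finitely generated submodule of the dual is the range of the transpose of a map to a free
module of finite rank. -/
theorem exists_range_lcomp_eq (K : Submodule Aᵐᵒᵖ (X →ₗ[A] A)) (hK : K.FG) :
    ∃ (r : ℕ) (H : X →ₗ[A] (Fin r → A)), LinearMap.range (LinearMap.lcomp Aᵐᵒᵖ A H) = K := by
  obtain ⟨r, s, rfl⟩ := Submodule.fg_iff_exists_fin_generating_family.1 hK
  refine ⟨r, LinearMap.pi s, le_antisymm ?_ ?_⟩
  · rintro _ ⟨c, rfl⟩
    obtain ⟨a, rfl⟩ := (ringDualPi A r).surjective c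
    have : LinearMap.lcomp Aᵐᵒᵖ A (LinearMap.pi s) (ringDualPi A r a) = ∑ i, a i • s i := by
      ext x
      simp [ringDualPi_apply]
    rw [this]
    exact Submodule.sum_mem _ fun i _ => Submodule.smul_mem _ _ (Submodule.subset_span ⟨i, rfl⟩)
  · rw [Submodule.span_le]
    rintro _ ⟨i, rfl⟩
    exact ⟨LinearMap.proj i, rfl⟩

theorem isSubAdditive_ringDual (hid : InjDimLE1 A) [IsNoetherianRing Aᵐᵒᵖ]
    {ψ : FGModuleCat.{0} Aᵐᵒᵖ → ℚ} (hψ : ψ ∈ AdditiveFunction Aᵐᵒᵖ) :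
    IsSubAdditive fun U : FGModuleCat.{0} A => ψ (.of Aᵐᵒᵖ (U →ₗ[A] A)) := by
  intro X Y Z _ _ _ _ _ _ _ _ _ f g _ hZ hf hg hfg
  rw [add_comm]
  refine AdditiveFunction.map_exact hψ (LinearMap.lcomp Aᵐᵒᵖ A g) (LinearMap.lcomp Aᵐᵒᵖ A f)
    (lcomp_injective hg) (hZ.exists_extension_to_ring hid f g hf hfg) ?_
  ext h
  constructor
  · rintro ⟨h', rfl⟩
    ext x
    have : f x ∈ LinearMap.ker g := hfg ▸ ⟨x, rfl⟩
    simp [LinearMap.mem_ker.1 this]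
  · intro hh
    refine exists_comp_eq_of_ker_le hg (hfg ▸ ?_)
    rintro _ ⟨x, rfl⟩
    exact LinearMap.congr_fun hh x

/-- The additive function agreeing with `ψ (Hom_A(X, A))` on submodules `X` of free modules. -/
noncomputable def AdditiveFunction.extendRingDual (hid : InjDimLE1 A) [IsNoetherianRing A]
    [IsNoetherianRing Aᵐᵒᵖ] : AdditiveFunction Aᵐᵒᵖ →ₗ[ℚ] AdditiveFunction A where
  toFun ψ := ⟨_, (isSubAdditive_ringDual hid ψ.2).additiveExtension_mem⟩
  map_add' ψ ψ' := Subtype.ext (funext fun U => by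
    simp only [additiveExtension, Submodule.coe_add, Pi.add_apply]
    ring)
  map_smul' c ψ := Subtype.ext (funext fun U => by
    simp only [additiveExtension, Submodule.coe_smul, Pi.smul_apply, RingHom.id_apply, smul_sub])

theorem AdditiveFunction.extendRingDual_apply (hid : InjDimLE1 A) [IsNoetherianRing A]
    [IsNoetherianRing Aᵐᵒᵖ] [Module.Finite A X] (hX : InSub A X) (ψ : AdditiveFunction Aᵐᵒᵖ) :
    (extendRingDual hid ψ).1 (.of A X) = ψ.1 (.of Aᵐᵒᵖ (X →ₗ[A] A)) :=
  (isSubAdditive_ringDual hid ψ.2).additiveExtension_eq_self hX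

theorem AdditiveFunction.extendRingDual_injective (hid : InjDimLE1 A) [IsNoetherianRing A]
    [IsNoetherianRing Aᵐᵒᵖ] : Function.Injective (extendRingDual hid) := by
  refine (injective_iff_map_eq_zero _).2 fun ψ hψ => Subtype.ext (funext fun V => ?_)
  have hzero : ∀ (X : Type) [AddCommGroup X] [Module A X] [Module.Finite A X], InSub A X →
      ψ.1 (.of Aᵐᵒᵖ (X →ₗ[A] A)) = 0 := fun X _ _ _ hX => by
    rw [← extendRingDual_apply hid hX ψ, hψ]
    rfl
  obtain ⟨n, π, hπ⟩ := Module.Finite.exists_fin' Aᵐᵒᵖ V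
  let T : ((Fin n → A) →ₗ[A] A) →ₗ[Aᵐᵒᵖ] V := π ∘ₗ (ringDualPi A n).symm.toLinearMap
  obtain ⟨m, F, hF⟩ := exists_range_lcomp_eq (LinearMap.ker T) (IsNoetherian.noetherian _)
  obtain ⟨r, H, hH⟩ := exists_range_lcomp_eq (LinearMap.ker (LinearMap.lcomp Aᵐᵒᵖ A F))
    (IsNoetherian.noetherian _)
  have hHF : H ∘ₗ F = 0 := by
    ext1 i
    ext j
    have : LinearMap.proj j ∘ₗ H ∈ LinearMap.ker (LinearMap.lcomp Aᵐᵒᵖ A F) :=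
      hH ▸ ⟨LinearMap.proj j, rfl⟩
    exact LinearMap.congr_fun (LinearMap.mem_ker.1 this) (Pi.single i 1)
  have hV := map_exact (X := LinearMap.ker T) ψ.2 (LinearMap.ker T).subtype T
    (Submodule.injective_subtype _)
    (hπ.comp (ringDualPi A n).symm.surjective) (by simp)
  have hm := map_exact (Z := LinearMap.ker T) ψ.2 (LinearMap.lcomp Aᵐᵒᵖ A H.rangeRestrict)
    ((LinearMap.lcomp Aᵐᵒᵖ A F).codRestrict (LinearMap.ker T) fun c => hF ▸ ⟨c, rfl⟩)
    (lcomp_injective H.surjective_rangeRestrict)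
    (fun ⟨c, hc⟩ => by
      rw [← hF] at hc
      obtain ⟨d, hd⟩ := hc
      exact ⟨d, Subtype.ext hd⟩)
    (by
      rw [LinearMap.ker_codRestrict]
      refine le_antisymm ?_ ?_
      · rintro _ ⟨c, rfl⟩
        ext i
        have : H.rangeRestrict (F (Pi.single i 1)) = 0 :=
          Subtype.ext (LinearMap.congr_fun hHF (Pi.single i 1))
        simp [this]
      · rw [← hH]
        rintro _ ⟨c, rfl⟩
        exact ⟨c ∘ₗ (LinearMap.range H).subtype, rfl⟩)
  rw [hzero _ (inSub_of_projective _), hzero (LinearMap.range H)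
    ((inSub_of_projective _).of_injective _ (LinearMap.range H).injective_subtype)] at hm
  rw [hzero _ (inSub_of_projective _)] at hV
  change ψ.1 (.of Aᵐᵒᵖ V) = 0
  linarith

end RingDual

section Cosyzygy

variable {A : Type} [Ring A]

theorem AdditiveFunction.exists_ringDual_eq (k : Type) [Field k] [Algebra k A]
    [FiniteDimensional k A] (hid : InjDimLE1 A) [IsNoetherianRing A]
    [IsNoetherianRing Aᵐᵒᵖ] (φ : FGModuleCat.{0} A → ℚ) (hφ : φ ∈ AdditiveFunction A) :
    ∃ ψ : AdditiveFunction Aᵐᵒᵖ, ∀ (X : Type) [AddCommGroup X] [Module A X] [Module.Finite A X],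
      InSub A X → φ (.of A X) = ψ.1 (.of Aᵐᵒᵖ (X →ₗ[A] A)) := by
  have : IsArtinianRing A := .of_finite k A
  let δ := precompDual (AlgEquiv.opOp k A : A →ₐ[k] Aᵐᵒᵖᵐᵒᵖ)
  have hδ : Function.Injective δ :=
    precompDual_injective (AlgEquiv.opOp k A) (AlgHom.id k Aᵐᵒᵖ) fun _ => rfl
  obtain ⟨φ', hφ'⟩ := LinearMap.surjective_of_injective
    (f := extendRingDual hid ∘ₗ δ) ((extendRingDual_injective hid).comp hδ) ⟨φ, hφ⟩
  refine ⟨δ φ', fun X _ _ _ hX => ?_⟩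
  rw [← extendRingDual_apply hid hX]
  exact congrFun (congrArg Subtype.val hφ'.symm) _

variable {X : Type} [AddCommGroup X] [Module A X]

/-- A submodule of a free module of finite rank embeds in such a module with torsionless
cokernel. -/
theorem InSub.exists_cosyzygy (k : Type) [Field k] [Algebra k A] [FiniteDimensional k A]
    (hid : InjDimLE1 A) (hX : InSub A X) :
    ∃ (n : ℕ) (Y : Type) (_ : AddCommGroup Y) (_ : Module A Y) (i : X →ₗ[A] (Fin n → A))
      (q : (Fin n → A) →ₗ[A] Y), InSub A Y ∧ Function.Injective i ∧ Function.Surjective q ∧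
      LinearMap.range i = LinearMap.ker q := by
  have : IsNoetherianRing A := .of_finite k A
  have : IsArtinianRing A := .of_finite k A
  have : IsNoetherianRing Aᵐᵒᵖ := .of_finite k Aᵐᵒᵖ
  have : Module.Finite A X := by
    obtain ⟨n, f, hf⟩ := hX
    exact .of_injective f hf
  obtain ⟨ψ, hψ⟩ := AdditiveFunction.exists_ringDual_eq k hid _
    (AdditiveFunction.length_mem (R := A))
  obtain ⟨n, H, hH⟩ := exists_range_lcomp_eq (⊤ : Submodule Aᵐᵒᵖ (X →ₗ[A] A))
    (IsNoetherian.noetherian _)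
  have hfactor : ∀ h : X →ₗ[A] A, ∃ c : (Fin n → A) →ₗ[A] A, c ∘ₗ H = h := fun h =>
    LinearMap.range_eq_top.1 hH h
  have hHinj : Function.Injective H := by
    obtain ⟨m, f, hf⟩ := hX
    intro x y hxy
    refine hf (funext fun j => ?_)
    obtain ⟨c, hc⟩ := hfactor (LinearMap.proj j ∘ₗ f)
    have := LinearMap.congr_fun hc
    simp only [LinearMap.comp_apply, LinearMap.proj_apply] at this
    rw [← this, ← this, hxy]
  obtain ⟨m, c, hc⟩ := exists_range_lcomp_eq (LinearMap.ker (LinearMap.lcomp Aᵐᵒᵖ A H))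
    (IsNoetherian.noetherian _)
  have hcH : ∀ x, c (H x) = 0 := fun x => by
    ext j
    have : LinearMap.proj j ∘ₗ c ∈ LinearMap.ker (LinearMap.lcomp Aᵐᵒᵖ A H) :=
      hc ▸ ⟨LinearMap.proj j, rfl⟩
    exact LinearMap.congr_fun (LinearMap.mem_ker.1 this) x
  let j : X →ₗ[A] LinearMap.ker c := H.codRestrict _ hcH
  have hj : Function.Injective j := fun x y h => hHinj (congrArg Subtype.val h)
  have hfree : InSub A (Fin n → A) := inSub_of_projective _
  have hfree' : InSub A (Fin m → A) := inSub_of_projective _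
  have hbij : Function.Bijective (LinearMap.lcomp Aᵐᵒᵖ A j) := by
    refine ⟨(injective_iff_map_eq_zero _).2 fun h hh => ?_, fun h => ?_⟩
    · obtain ⟨h', rfl⟩ := hfree'.exists_extension_to_ring hid (LinearMap.ker c).subtype c
        (Submodule.injective_subtype _) (by simp) h
      have : h' ∈ LinearMap.range (LinearMap.lcomp Aᵐᵒᵖ A c) := by
        rw [hc]
        exact hh
      obtain ⟨d, rfl⟩ := this
      ext ⟨y, hy⟩
      simp [LinearMap.mem_ker.1 hy]
    · obtain ⟨h', rfl⟩ := hfactor h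
      exact ⟨h' ∘ₗ (LinearMap.ker c).subtype, rfl⟩
  have hlen := AdditiveFunction.map_linearEquiv ψ.2 (LinearEquiv.ofBijective _ hbij)
  rw [← hψ _ hX, ← hψ _ (hfree.of_injective _ (LinearMap.ker c).injective_subtype),
    AdditiveFunction.map_exact AdditiveFunction.length_mem j (LinearMap.range j).mkQ hj
      (Submodule.mkQ_surjective _) (by simp), add_eq_left] at hlen
  have hsurj : LinearMap.range j = ⊤ := by
    have hne : Module.length A (LinearMap.ker c ⧸ LinearMap.range j) ≠ ⊤ := Module.length_ne_top
    have h0 : (Module.length A (LinearMap.ker c ⧸ LinearMap.range j)).toNat = 0 := by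
      exact_mod_cast hlen
    rw [ENat.toNat_eq_zero] at h0
    exact Submodule.Quotient.subsingleton_iff.1
      (Module.length_eq_zero_iff.1 (h0.resolve_right hne))
  refine ⟨n, LinearMap.range c, inferInstance, inferInstance, H, c.rangeRestrict,
    hfree'.of_injective _ (LinearMap.range c).injective_subtype, hHinj,
    c.surjective_rangeRestrict, ?_⟩
  rw [LinearMap.ker_rangeRestrict]
  refine le_antisymm ?_ fun y hy => ?_
  · rintro _ ⟨x, rfl⟩
    exact hcH x
  · obtain ⟨x, hx⟩ := LinearMap.range_eq_top.1 hsurj ⟨y, hy⟩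
    exact ⟨x, congrArg Subtype.val hx⟩

end Cosyzygy

section ClusterTilting

variable {A : Type} [Ring A] {M K P X J Y : Type} [AddCommGroup M] [AddCommGroup K]
  [AddCommGroup P] [AddCommGroup X] [AddCommGroup J] [AddCommGroup Y] [Module A M] [Module A K]
  [Module A P] [Module A X] [Module A J] [Module A Y] {i : K →ₗ[A] P} {p : P →ₗ[A] M}
  {f : X →ₗ[A] J} {g : J →ₗ[A] Y}

theorem projective_pi_fin [Module.Projective A P] (n : ℕ) : Module.Projective A (Fin n → P) :=
  .of_equiv (DFinsupp.linearEquivFunOnFintype (R := A) (M := fun _ : Fin n => P))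

theorem inAdd_prod_syzygy_iff [Module.Finite A P] [Module.Projective A P] [Module.Finite A J]
    [Module.Projective A J] (hid : InjDimLE1 A) (hM : InSub A M) (hY : InSub A Y)
    (hMA : InAdd A M A) (hi : Function.Injective i) (hp : Function.Surjective p)
    (hip : LinearMap.range i = LinearMap.ker p) (hf : Function.Injective f)
    (hg : Function.Surjective g) (hfg : LinearMap.range f = LinearMap.ker g) :
    InAdd A (A × K) X ↔ InAdd A M Y := by
  constructor
  · rintro ⟨n, s, r, hrs⟩
    have := projective_pi_fin (A := A) (P := A × P) n
    obtain ⟨s', r', h'⟩ := exists_retract_cokernel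
      (i := (LinearMap.id.prodMap i).compLeft (Fin n))
      (π := (p ∘ₗ LinearMap.snd A A P).compLeft (Fin n)) hid (hM.pi n) hY
      (fun a b h => funext fun j =>
        (Function.injective_id.prodMap hi : Function.Injective (LinearMap.id.prodMap i))
          (congrFun h j))
      (fun z => ⟨fun j => (0, (hp (z j)).choose), funext fun j => (hp (z j)).choose_spec⟩)
      (LinearMap.range_compLeft_eq_ker (by
        rw [LinearMap.range_prodMap, hip, LinearMap.ker_comp]
        ext
        simp) n) hf hg hfg s r hrs
    exact ((InAdd.refl.pi n).prod (.of_projective hMA J)).of_retract s' r' h'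
  · rintro ⟨n, s, r, hrs⟩
    have := projective_pi_fin (A := A) (P := P) n
    obtain ⟨s', r', h'⟩ := exists_retract_kernel (i := i.compLeft (Fin n))
      (π := p.compLeft (Fin n)) (fun a b h => funext fun j => hi (congrFun h j))
      (fun z => ⟨fun j => (hp (z j)).choose, funext fun j => (hp (z j)).choose_spec⟩)
      (LinearMap.range_compLeft_eq_ker hip n) hf hg hfg s r hrs
    have hA : InAdd A (A × K) A :=
      InAdd.refl.of_retract (LinearMap.inl A A K) (LinearMap.fst A A K) rfl
    have hK : InAdd A (A × K) K :=
      InAdd.refl.of_retract (LinearMap.inr A A K) (LinearMap.snd A A K) rfl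
    exact ((hK.pi n).prod (.of_projective hA J)).of_retract s' r' h'

theorem IsClusterTilting.prod_syzygy (k : Type) [Field k] [Algebra k A] [FiniteDimensional k A]
    [Module.Finite A P] [Module.Projective A P] (hid : InjDimLE1 A) (hM : IsClusterTilting A M)
    (hi : Function.Injective i) (hp : Function.Surjective p)
    (hip : LinearMap.range i = LinearMap.ker p) : IsClusterTilting A (A × K) := by
  have hK : InSub A K := (inSub_of_projective P).of_injective i hi
  have hMA : InAdd A M A := (hM.2 A (inSub_of_projective A)).2.1 ext1Zero_of_projective
  refine ⟨(inSub_of_projective A).prod hK, fun X _ _ hX => ?_⟩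
  obtain ⟨n, Y, _, _, f, g, hY, hf, hg, hfg⟩ := hX.exists_cosyzygy k hid
  rw [inAdd_prod_syzygy_iff hid hM.1 hY hMA hi hp hip hf hg hfg]
  constructor
  · rw [ext1Zero_prod_left_iff, ext1Zero_shift_iff hid hK hM.1 hi hp hip hf hg hfg]
    exact (hM.2 Y hY).1
  · rw [ext1Zero_prod_right_iff hid hX, ext1Zero_shift_iff hid hX hY hf hg hfg hi hp hip]
    exact (hM.2 Y hY).2

end ClusterTilting

/-- The source of a superfluous epimorphism onto a finitely generated module is finitely
generated. -/
theorem Module.Finite.of_superfluous {R M P : Type} [Ring R] [AddCommGroup M] [AddCommGroup P]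
    [Module R M] [Module R P] [Module.Finite R M] {p : P →ₗ[R] M} (hp : Function.Surjective p)
    (hsmall : ∀ N : Submodule R P, N ⊔ LinearMap.ker p = ⊤ → N = ⊤) : Module.Finite R P := by
  obtain ⟨n, s, hs⟩ := Module.Finite.exists_fin (R := R) (M := M)
  choose t ht using fun i => hp (s i)
  refine ⟨hsmall (Submodule.span R (Set.range t)) ?_ ▸
    Submodule.fg_span (Set.finite_range t)⟩
  rw [← Submodule.comap_map_eq, Submodule.map_span, ← Set.range_comp,
    show ⇑p ∘ t = s from funext ht, hs, Submodule.comap_top]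

theorem syzygy_of_cluster_tilting
    (k : Type) [Field k] (A : Type) [Ring A] [Algebra k A] [FiniteDimensional k A]
    (hid : InjDimLE1 A)
    (M : Type) [AddCommGroup M] [Module A M] (hM : IsClusterTilting A M)
    -- a projective cover p : P → M, with syzygy ΩM = ker p :
    (P : Type) [AddCommGroup P] [Module A P] (hP : Module.Projective A P)
    (p : P →ₗ[A] M) (hp : Function.Surjective p)
    (hsmall : ∀ N : Submodule A P, N ⊔ LinearMap.ker p = ⊤ → N = ⊤) :
    IsClusterTilting A (A × LinearMap.ker p) ∧
    Nonempty (StableEnd A M ≃+* StableEnd A (LinearMap.ker p)) := by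
  have : IsNoetherianRing A := .of_finite k A
  have : Module.Finite A M := by
    obtain ⟨n, f, hf⟩ := hM.1
    exact .of_injective f hf
  have : Module.Finite A P := .of_superfluous hp hsmall
  exact ⟨hM.prod_syzygy k hid (LinearMap.ker p).injective_subtype hp (Submodule.range_subtype _),
    nonempty_stableEnd_equiv_syzygy hid hM.1 hp⟩
end
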